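/- arXiv:1310.7647 — 13 statements merged into one kernel-verified Lean document; each statement's English description precedes it below -/
import Mathlib

section
/- Let n ≥ 1 be an integer and set d = 2^n − 1. Let ε_0, ε_1, …, ε_d ∈ {−1, +1} be signs such that Σ_{k=0}^{d} ε_k ≡ 2 (mod 4). Then the polynomial f(x) = ε_0 + ε_1 x + ε_2 x² + ⋯ + ε_d x^d is irreducible in ℤ[x]. -/
open Polynomial in
/-- Over `ZMod 2`, the geometric sum `1 + X + ⋯ + X ^ (2 ^ n - 1)` shifted by `1` is
`X ^ (2 ^ n - 1)`. -/
theorem taylor_one_geom_sum_two_pow (n : ℕ) :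
    taylor 1 (∑ k ∈ Finset.range (2 ^ n), (X : (ZMod 2)[X]) ^ k) = X ^ (2 ^ n - 1) := by
  apply mul_right_cancel₀ (X_ne_zero (R := ZMod 2))
  have hgeom := congrArg (taylor (1 : ZMod 2)) (geom_sum_mul (X : (ZMod 2)[X]) (2 ^ n))
  simp only [taylor_mul, map_sub, taylor_X, taylor_pow, taylor_one, C_1, add_sub_cancel_right]
    at hgeom
  rw [hgeom, add_pow_char_pow, one_pow, add_sub_cancel_right, ← pow_succ,
    Nat.sub_add_cancel Nat.one_le_two_pow]

open Polynomial in
theorem coeff_sum_range_C_mul_X_pow {R : Type*} [Semiring R] (a : ℕ → R) (d m : ℕ) :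
    (∑ k ∈ Finset.range (d + 1), C (a k) * X ^ k).coeff m = if m ≤ d then a m else 0 := by
  simp [coeff_X_pow]

open Polynomial in
theorem natDegree_sum_range_C_mul_X_pow {R : Type*} [Semiring R] {a : ℕ → R} {d : ℕ}
    (ha : a d ≠ 0) : (∑ k ∈ Finset.range (d + 1), C (a k) * X ^ k).natDegree = d := by
  apply natDegree_eq_of_le_of_coeff_ne_zero
  · rw [natDegree_le_iff_coeff_eq_zero]
    intro m hm
    rw [coeff_sum_range_C_mul_X_pow, if_neg (by omega)]
  · simpa [coeff_sum_range_C_mul_X_pow] using ha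

/-- Let `n ≥ 1` and `d = 2^n - 1`. If `ε_0, …, ε_d ∈ {−1, +1}` satisfy
`Σ ε_k ≡ 2 (mod 4)`, then `f(x) = Σ_{k=0}^d ε_k x^k` is irreducible in `ℤ[x]`. -/
theorem stmt_0 (n : ℕ) (hn : 1 ≤ n) (d : ℕ) (hd : d = 2 ^ n - 1)
    (ε : ℕ → ℤ) (hε : ∀ k ≤ d, ε k = 1 ∨ ε k = -1)
    (hsum : (∑ k ∈ Finset.range (d + 1), ε k) % 4 = 2) :
    Irreducible (∑ k ∈ Finset.range (d + 1), Polynomial.C (ε k) * Polynomial.X ^ k) := by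
  open Polynomial in
  set f : ℤ[X] := ∑ k ∈ Finset.range (d + 1), C (ε k) * X ^ k with hf
  have hd1 : d + 1 = 2 ^ n := by have := Nat.one_le_two_pow (n := n); omega
  have hd0 : 0 < d := by have := Nat.pow_le_pow_right (n := 2) (by norm_num) hn; omega
  have hunit : IsUnit (ε d) := Int.isUnit_iff.2 (hε d le_rfl)
  have hdeg : f.natDegree = d := natDegree_sum_range_C_mul_X_pow hunit.ne_zero
  have hlead : (taylor 1 f).leadingCoeff = ε d := by
    rw [leadingCoeff_taylor, leadingCoeff, hdeg, hf, coeff_sum_range_C_mul_X_pow, if_pos le_rfl]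
  have htdeg : (taylor 1 f).natDegree = d := by rw [natDegree_taylor, hdeg]
  have hmod : (taylor 1 f).map (Int.castRingHom (ZMod 2)) = X ^ d := by
    rw [map_taylor, map_one, hd, ← taylor_one_geom_sum_two_pow, ← hd1, hf, Polynomial.map_sum]
    congr 1
    refine Finset.sum_congr rfl fun k hk ↦ ?_
    have hk1 : ((ε k : ℤ) : ZMod 2) = 1 := by
      rcases hε k (Nat.lt_succ_iff.1 (Finset.mem_range.1 hk)) with h | h <;> rw [h] <;> rfl
    rw [Polynomial.map_mul, map_C, Polynomial.map_pow, map_X, eq_intCast, hk1, C_1, one_mul]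
  have hprime : (Ideal.span {(2 : ℤ)}).IsPrime :=
    (Ideal.span_singleton_prime two_ne_zero).2 Int.prime_two
  refine (MulEquiv.irreducible_iff (taylorEquiv (1 : ℤ))).1 ?_
  change Irreducible (taylor 1 f)
  refine irreducible_of_eisenstein_criterion hprime ?_ ?_ ?_ ?_ ?_
  · rw [hlead]
    exact fun h ↦ hprime.ne_top (Ideal.eq_top_of_isUnit_mem _ h hunit)
  · intro m hm
    rw [Ideal.mem_span_singleton]
    have hm' : m ≠ d := by
      have := coe_lt_degree.1 hm
      omega
    have hc := congrArg (coeff · m) hmod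
    simp only [coeff_map, coeff_X_pow, if_neg hm', eq_intCast] at hc
    exact_mod_cast (ZMod.intCast_zmod_eq_zero_iff_dvd _ 2).1 hc
  · rw [← natDegree_pos_iff_degree_pos, htdeg]
    exact hd0
  · rw [Ideal.span_singleton_pow, Ideal.mem_span_singleton, taylor_coeff_zero, hf,
      eval_finsetSum]
    simp only [eval_mul, eval_C, eval_pow, eval_X, one_pow, mul_one]
    omega
  · intro r hr
    refine isUnit_of_dvd_unit ?_ hunit
    rw [← hlead]
    exact (C_dvd_iff_dvd_coeff _ _).1 hr _
end

section
/- Let v_1, …, v_n ∈ ℝ^d be non-zero vectors which span ℝ^d, and suppose that the convex hull of {v_1, …, v_n} contains the origin in its interior. Then there exists R > 0 such that for every r ≥ R, writing B for the open ball of radius r centered at the origin, the closure of B is contained in the interior of ⋃_{i=1}^{n} (v_i + B). -/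
/-- If the convex hull of `s` contains `closedBall 0 ε`, then every vector `x` has inner product
at least `ε * ‖x‖` with some element of `s`. -/
theorem exists_mul_norm_le_inner_of_closedBall_subset_convexHull {E : Type*}
    [NormedAddCommGroup E] [InnerProductSpace ℝ E] {s : Set E} {ε : ℝ} (hε : 0 ≤ ε)
    (hs : Metric.closedBall 0 ε ⊆ convexHull ℝ s) (x : E) :
    ∃ y ∈ s, ε * ‖x‖ ≤ inner ℝ x y := by
  have hy : (ε / ‖x‖) • x ∈ convexHull ℝ s := by
    apply hs
    rw [mem_closedBall_zero_iff, norm_smul, Real.norm_of_nonneg (by positivity)]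
    exact mul_le_of_le_div₀ hε (norm_nonneg x) le_rfl
  obtain ⟨y, hys, hxy⟩ :=
    ((innerSL ℝ x).toLinearMap.convexOn (convex_convexHull ℝ s)).exists_ge_of_mem_convexHull
      (subset_convexHull ℝ s) hy
  refine ⟨y, hys, le_of_eq_of_le ?_ hxy⟩
  rcases eq_or_ne x 0 with rfl | hx
  · simp
  · have : ‖x‖ ≠ 0 := norm_ne_zero_iff.2 hx
    simp only [ContinuousLinearMap.coe_coe, innerSL_apply_apply, real_inner_smul_right,
      real_inner_self_eq_norm_sq]
    field_simp

theorem norm_sub_lt_of_mul_norm_le_inner {E : Type*} [NormedAddCommGroup E]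
    [InnerProductSpace ℝ E] {x y : E} {ε M r : ℝ} (hxy : ε * ‖x‖ ≤ inner ℝ x y)
    (hy : ‖y‖ ≤ M) (hx : ‖x‖ ≤ r) (hMr : M < r) (hr : M ^ 2 < 2 * ε * r) :
    ‖x - y‖ < r := by
  have hy0 := norm_nonneg y
  have hx0 := norm_nonneg x
  refine lt_of_pow_lt_pow_left₀ 2 (by linarith) ?_
  rw [norm_sub_sq_real]
  have hyM : ‖y‖ ^ 2 ≤ M ^ 2 := by gcongr
  rcases le_total ‖x‖ (2 * ε) with h | h
  · nlinarith [mul_nonneg hx0 (sub_nonneg.2 h)]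
  · nlinarith [mul_nonneg (sub_nonneg.2 hx) (sub_nonneg.2 h),
      mul_nonneg (sub_nonneg.2 hx) (hx0.trans hx)]

/-- Let `v_1, …, v_n ∈ ℝ^d` be nonzero vectors spanning `ℝ^d` whose convex
hull contains the origin in its interior. Then there is `R > 0` such that for every
`r ≥ R`, the closure of the open ball `B` of radius `r` centered at `0` is contained in
the interior of `⋃ i (v_i + B)`. -/
theorem stmt_4 (d n : ℕ) (v : Fin n → EuclideanSpace ℝ (Fin d))
    (hv : ∀ i, v i ≠ 0)
    (hspan : Submodule.span ℝ (Set.range v) = ⊤)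
    (h0 : (0 : EuclideanSpace ℝ (Fin d)) ∈ interior (convexHull ℝ (Set.range v))) :
    ∃ R > (0 : ℝ), ∀ r ≥ R,
      closure (Metric.ball (0 : EuclideanSpace ℝ (Fin d)) r) ⊆
        interior (⋃ i, (fun x => v i + x) '' Metric.ball (0 : EuclideanSpace ℝ (Fin d)) r) := by
  obtain ⟨ε, hε, hball⟩ := Metric.nhds_basis_closedBall.mem_iff.1 (mem_interior_iff_mem_nhds.1 h0)
  set M := ∑ i, ‖v i‖
  have hM0 : 0 ≤ M := by positivity
  refine ⟨M + M ^ 2 / ε + 1, by positivity, fun r hr x hx => ?_⟩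
  have hopen : IsOpen (⋃ i, (fun x => v i + x) '' Metric.ball 0 r) :=
    isOpen_iUnion fun i => isOpenMap_add_left (v i) _ Metric.isOpen_ball
  rw [hopen.interior_eq]
  obtain ⟨_, ⟨i, rfl⟩, hi⟩ :=
    exists_mul_norm_le_inner_of_closedBall_subset_convexHull hε.le hball x
  have hxr : ‖x‖ ≤ r := mem_closedBall_zero_iff.1 (Metric.closure_ball_subset_closedBall hx)
  have hvM : ‖v i‖ ≤ M :=
    Finset.single_le_sum (fun j _ => norm_nonneg (v j)) (Finset.mem_univ i)
  have hq : 0 ≤ M ^ 2 / ε := by positivity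
  have hlt : M ^ 2 < r * ε := (div_lt_iff₀ hε).1 (by linarith)
  refine Set.mem_iUnion.2 ⟨i, x - v i, ?_, add_sub_cancel _ _⟩
  exact mem_ball_zero_iff.2
    (norm_sub_lt_of_mul_norm_le_inner hi hvM hxr (by linarith) (by nlinarith [sq_nonneg M]))
end

section
/- Fix an integer R ≥ 6 with R ≡ 0 (mod 4), and let B := [−R, R] × [−R, R] ⊆ ℝ² be the closed square with vertices (±R, ±R). Then there exists a positive integer n such that B ⊆ ⋃_{v ∈ Λ_n} ( v + (1/2)·T^{3n}(B) ), where T^{3n}(B) denotes the image of B under the 3n-th iterate of T and (1/2)·S denotes the scaling of a set S by the factor 1/2. -/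
/-- The vectors `V_j := (1, 3j+3) ∈ ℝ²`. -/
def Vvec (j : ℕ) : ℝ × ℝ := (1, 3 * (j : ℝ) + 3)

/-- `Λ_n := { Σ_{j=0}^{n−1} ε_j V_j : ε_j ∈ {−1, +1} }`. -/
def Lam (n : ℕ) : Set (ℝ × ℝ) :=
  {q | ∃ ε : Fin n → ℝ, (∀ j, ε j = 1 ∨ ε j = -1) ∧ q = ∑ j, ε j • Vvec (j : ℕ)}

/-- The linear map `T(x,y) = (x, x+y)` with matrix `[[1,0],[1,1]]`. -/
def Tmap (p : ℝ × ℝ) : ℝ × ℝ := (p.1, p.1 + p.2)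

/-- Every integer between the least and the greatest sum of an `m`-element subset of
`{0, …, n - 1}` is the sum of such a subset. -/
theorem exists_subset_range_card_sum (n m : ℕ) (s : ℤ) (hm : m ≤ n)
    (hlo : (m : ℤ) * (m - 1) ≤ 2 * s)
    (hhi : 2 * s ≤ (m : ℤ) * (m - 1) + 2 * m * (n - m)) :
    ∃ A ⊆ Finset.range n, A.card = m ∧ ∑ j ∈ A, (j : ℤ) = s := by
  induction n generalizing m s with
  | zero =>
    obtain rfl : m = 0 := by omega
    refine ⟨∅, by simp, rfl, ?_⟩
    simp at hlo hhi ⊢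
    omega
  | succ n ih =>
    push_cast at hhi
    by_cases hsmall : m ≤ n ∧ 2 * s ≤ (m : ℤ) * (m - 1) + 2 * m * (n - m)
    · obtain ⟨A, hA, hcard, hsum⟩ := ih m s hsmall.1 hlo hsmall.2
      exact ⟨A, hA.trans (Finset.range_mono n.le_succ), hcard, hsum⟩
    · obtain _ | k := m
      · simp at hsmall hlo hhi
        omega
      push_cast at hlo hhi hsmall
      have hk : (k : ℤ) ≤ n := by omega
      have hlo' : (k : ℤ) * (k - 1) ≤ 2 * (s - n) := by
        by_cases hkn : k + 1 ≤ n
        · have hlt := not_le.mp fun h => hsmall ⟨hkn, h⟩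
          have hkn' : (k : ℤ) + 1 ≤ n := by exact_mod_cast hkn
          obtain ⟨c, hc⟩ := Int.even_mul_succ_self (k : ℤ)
          have hlt' : c + (k + 1) * (n - (k + 1)) < s := by linarith
          nlinarith [mul_nonneg (Int.natCast_nonneg k) (sub_nonneg.mpr hkn')]
        · obtain rfl : k = n := by omega
          nlinarith
      obtain ⟨A, hA, hcard, hsum⟩ := ih k (s - n) (by omega) hlo' (by nlinarith)
      have hn : n ∉ A := fun h => by simpa using hA h
      refine ⟨insert n A, ?_, by rw [Finset.card_insert_of_notMem hn, hcard], ?_⟩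
      · rw [Finset.range_add_one]
        exact Finset.insert_subset_insert n hA
      · rw [Finset.sum_insert hn, hsum]
        ring

/-- A signed sum whose positive signs are those of the indices in `A`. -/
theorem sum_range_sign_mul {n : ℕ} {A : Finset ℕ} (hA : A ⊆ Finset.range n) (f : ℕ → ℝ) :
    ∑ j ∈ Finset.range n, (if j ∈ A then 1 else -1) * f j =
      2 * ∑ j ∈ A, f j - ∑ j ∈ Finset.range n, f j := by
  have h : ∑ j ∈ A, f j = ∑ j ∈ Finset.range n, if j ∈ A then f j else 0 := by
    rw [Finset.sum_ite_mem, Finset.inter_eq_right.mpr hA]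
  rw [h, Finset.mul_sum, ← Finset.sum_sub_distrib]
  refine Finset.sum_congr rfl fun j _ => ?_
  split_ifs <;> ring

theorem sum_range_natCast_real (n : ℕ) :
    ∑ j ∈ Finset.range n, (j : ℝ) = n * (n - 1) / 2 := by
  induction n with
  | zero => simp
  | succ n ih =>
    rw [Finset.sum_range_succ, ih]
    push_cast
    ring

/-- Sign vectors with `m` positive entries, whose indices add up to `s`, give an element of
`Lam n`. -/
theorem mem_Lam_of_card_sum (n m : ℕ) (s : ℤ) (hm : m ≤ n)
    (hlo : (m : ℤ) * (m - 1) ≤ 2 * s)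
    (hhi : 2 * s ≤ (m : ℤ) * (m - 1) + 2 * m * (n - m)) :
    ((2 * m - n, 3 * (2 * s - n * (n - 1) / 2) + 3 * (2 * m - n)) : ℝ × ℝ) ∈ Lam n := by
  obtain ⟨A, hA, hcard, hsum⟩ := exists_subset_range_card_sum n m s hm hlo hhi
  have hsum' : ∑ j ∈ A, (j : ℝ) = s := by simp [← hsum]
  have hfst := sum_range_sign_mul hA fun _ => 1
  have hsnd := sum_range_sign_mul hA fun j => 3 * (j : ℝ) + 3
  simp only [Finset.sum_add_distrib, ← Finset.mul_sum, hsum', sum_range_natCast_real,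
    Finset.sum_const, hcard, Finset.card_range, nsmul_eq_mul] at hfst hsnd
  refine ⟨fun j => if (j : ℕ) ∈ A then 1 else -1, fun j => by dsimp only; split_ifs <;> simp, ?_⟩
  rw [Fin.sum_univ_eq_sum_range fun j => (if j ∈ A then (1 : ℝ) else -1) • Vvec j]
  ext
  · simp only [Prod.fst_sum, Prod.smul_fst, Vvec, smul_eq_mul, hfst]
    ring
  · simp only [Prod.snd_sum, Prod.smul_snd, Vvec, smul_eq_mul, hsnd]
    ring

theorem Tmap_iterate (k : ℕ) (p : ℝ × ℝ) : Tmap^[k] p = (p.1, k * p.1 + p.2) := by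
  induction k with
  | zero => simp
  | succ k ih =>
    rw [Function.iterate_succ_apply', ih, Tmap]
    push_cast
    ext <;> ring

open Pointwise in
theorem mem_translate_half_Tmap_iterate {R p q : ℝ} {v : ℝ × ℝ} (k : ℕ)
    (hfst : |p - v.1| ≤ R / 2) (hsnd : |q - v.2 - k * (p - v.1)| ≤ R / 2) :
    (p, q) ∈ (fun x => v + x) ''
      ((1 / 2 : ℝ) • (Tmap^[k] '' (Set.Icc (-R) R ×ˢ Set.Icc (-R) R))) := by
  rw [abs_le] at hfst hsnd
  refine ⟨_, Set.smul_mem_smul_set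
    ⟨(2 * (p - v.1), 2 * (q - v.2 - k * (p - v.1))), ?_, rfl⟩, ?_⟩
  · constructor <;> constructor <;> dsimp only <;> linarith
  · rw [Tmap_iterate]
    ext
    · simp
    · simp
      ring

/-- The sum `s` of the indices of the positive signs in the vector of `Lam (16 * r)` that
covers `(p, q)`. The sign `σ` is that of `p`. -/
theorem exists_index_sum {r σ p q : ℝ} (hr : 2 ≤ r) (hσ : σ = 1 ∨ σ = -1)
    (hp : |p - 2 * r * σ| ≤ 2 * r) (hq : |q| ≤ 4 * r) :
    ∃ s : ℤ, |q - 48 * r * p - 6 * s + 24 * r * (16 * r - 1) + 6 * (16 * r - 1) * r * σ| ≤ 2 * r ∧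
      (8 * r + r * σ) * (8 * r + r * σ - 1) ≤ 2 * s ∧
      2 * s ≤ (8 * r + r * σ) * (8 * r + r * σ - 1) +
        2 * (8 * r + r * σ) * (16 * r - (8 * r + r * σ)) := by
  set X := q - 48 * r * p + 24 * r * (16 * r - 1) + 6 * (16 * r - 1) * r * σ with hX
  have hround := abs_le.mp (abs_sub_round (X / 6))
  rw [abs_le] at hp hq
  have h1 : r * (p - 2 * r * σ) ≤ r * (2 * r) := by gcongr; exact hp.2
  have h2 : r * -(2 * r) ≤ r * (p - 2 * r * σ) := by gcongr; exact hp.1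
  refine ⟨round (X / 6), ?_, ?_, ?_⟩
  · rw [abs_le]
    constructor <;> linarith
  all_goals rcases hσ with rfl | rfl <;> nlinarith

open Pointwise in
/-- Fix an integer `R ≥ 6` with `R ≡ 0 (mod 4)`, and let
`B := [−R, R] × [−R, R]`. Then there is a positive integer `n` with
`B ⊆ ⋃_{v ∈ Λ_n} (v + (1/2)·T^{3n}(B))`. -/
theorem stmt_6 (R : ℤ) (hR6 : 6 ≤ R) (hR4 : R % 4 = 0) :
    ∃ n : ℕ, 0 < n ∧
      Set.Icc (-(R : ℝ)) (R : ℝ) ×ˢ Set.Icc (-(R : ℝ)) (R : ℝ) ⊆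
        ⋃ v ∈ Lam n, (fun x => v + x) ''
          ((1 / 2 : ℝ) • (Tmap^[3 * n] ''
            (Set.Icc (-(R : ℝ)) (R : ℝ) ×ˢ Set.Icc (-(R : ℝ)) (R : ℝ)))) := by
  obtain ⟨r, rfl⟩ : ∃ r : ℕ, R = 4 * r := ⟨(R / 4).toNat, by omega⟩
  have hr : 2 ≤ r := by omega
  have hr' : (2 : ℝ) ≤ r := by exact_mod_cast hr
  refine ⟨16 * r, by omega, ?_⟩
  push_cast
  rintro ⟨p, q⟩ ⟨⟨hp₁, hp₂⟩, hq⟩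
  dsimp only at hp₁ hp₂ hq
  obtain ⟨σ, hσ, hp⟩ : ∃ σ : ℤ, (σ = 1 ∨ σ = -1) ∧ |p - 2 * r * σ| ≤ 2 * r := by
    rcases le_total 0 p with h | h
    · refine ⟨1, Or.inl rfl, ?_⟩
      rw [abs_le]
      constructor <;> push_cast <;> linarith
    · refine ⟨-1, Or.inr rfl, ?_⟩
      rw [abs_le]
      constructor <;> push_cast <;> linarith
  obtain ⟨s, hs, hlo, hhi⟩ := exists_index_sum hr' (by exact_mod_cast hσ) hp (abs_le.mpr hq)
  obtain ⟨m, hm⟩ : ∃ m : ℕ, (m : ℤ) = 8 * r + r * σ := by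
    refine ⟨(8 * r + r * σ : ℤ).toNat, Int.toNat_of_nonneg ?_⟩
    rcases hσ with rfl | rfl <;> omega
  have hmn : m ≤ 16 * r := by rcases hσ with rfl | rfl <;> omega
  have hm' : (m : ℝ) = 8 * r + r * σ := by exact_mod_cast congrArg (Int.cast (R := ℝ)) hm
  have hv := mem_Lam_of_card_sum (16 * r) m s hmn
    (by rw [hm]; exact_mod_cast hlo) (by push_cast; rw [hm]; exact_mod_cast hhi)
  refine Set.mem_iUnion₂.mpr ⟨_, hv, mem_translate_half_Tmap_iterate _ ?_ ?_⟩
  · push_cast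
    rw [hm']
    convert hp using 2 <;> ring
  · push_cast
    rw [hm']
    convert hs using 2 <;> ring
end

section
/- Let n ≥ 1 and let a be an integer with |a| ≤ n and a ≡ n (mod 2). Define M_{a,n} := (6a(n+1) + 3(n² − a²))/4 and m_{a,n} := (6a(n+1) − 3(n² − a²))/4. Then Λ_n contains every point (a, b) ∈ ℤ² such that m_{a,n} ≤ b ≤ M_{a,n} and b ≡ M_{a,n} (mod 6). -/
/-- Every `t ≤ k * l` is attained as the excess of the weighted sign sum `∑ ε_j (j + 1)` over its
minimum, among the sign patterns of length `k + l` with `k` plus signs. -/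
lemma exists_signs (n : ℕ) : ∀ k l t : ℕ, k + l = n → t ≤ k * l →
    ∃ ε : ℕ → ℤ, (∀ j, ε j = 1 ∨ ε j = -1) ∧
      ∑ j ∈ Finset.range n, ε j = (k : ℤ) - l ∧
      2 * ∑ j ∈ Finset.range n, ε j * ((j : ℤ) + 1) =
        2 * k * (k + 1) + 4 * t - (k + l) * (k + l + 1) := by
  induction n with
  | zero =>
    intro k l t hkl ht
    obtain ⟨rfl, rfl⟩ : k = 0 ∧ l = 0 := by omega
    obtain rfl : t = 0 := by omega
    exact ⟨fun _ => 1, fun _ => Or.inl rfl, by simp, by simp⟩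
  | succ n ih =>
    intro k l t hkl ht
    have extend : ∀ (ε : ℕ → ℤ) (c : ℤ), (∀ j, ε j = 1 ∨ ε j = -1) → (c = 1 ∨ c = -1) →
        ∃ δ : ℕ → ℤ, (∀ j, δ j = 1 ∨ δ j = -1) ∧
          ∑ j ∈ Finset.range (n + 1), δ j = ∑ j ∈ Finset.range n, ε j + c ∧
          ∑ j ∈ Finset.range (n + 1), δ j * ((j : ℤ) + 1) =
            ∑ j ∈ Finset.range n, ε j * ((j : ℤ) + 1) + c * ((n : ℤ) + 1) := by
      intro ε c hε hc
      have hne : ∀ j ∈ Finset.range n, j ≠ n := fun j hj => (Finset.mem_range.mp hj).ne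
      refine ⟨fun j => if j = n then c else ε j, fun j => ?_, ?_, ?_⟩
      · by_cases hj : j = n
        · simpa [hj] using hc
        · simpa [hj] using hε j
      · simp only [Finset.sum_range_succ, if_true]
        congr 1
        exact Finset.sum_congr rfl fun j hj => if_neg (hne j hj)
      · simp only [Finset.sum_range_succ, if_true]
        congr 1
        exact Finset.sum_congr rfl fun j hj => by simp only [if_neg (hne j hj)]
    by_cases h : 1 ≤ k ∧ l ≤ t
    · obtain ⟨k, rfl⟩ := Nat.exists_eq_add_of_le' h.1
      obtain ⟨t, rfl⟩ := Nat.exists_eq_add_of_le' h.2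
      obtain ⟨ε, hε, h₁, h₂⟩ := ih k l t (by omega) (by rw [add_mul] at ht; omega)
      obtain ⟨δ, hδ, e₁, e₂⟩ := extend ε 1 hε (Or.inl rfl)
      obtain rfl : n = k + l := by omega
      refine ⟨δ, hδ, ?_, ?_⟩
      · rw [e₁, h₁]; push_cast; ring
      · rw [e₂, mul_add, h₂]; push_cast; ring
    · obtain ⟨l, rfl⟩ : ∃ l', l = l' + 1 := by
        refine Nat.exists_eq_add_of_le' (Nat.one_le_iff_ne_zero.mpr ?_)
        rintro rfl
        exact h ⟨by omega, Nat.zero_le t⟩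
      have ht' : t ≤ k * l := by
        rcases Nat.eq_zero_or_pos k with rfl | hk
        · simpa using ht
        · have : t ≤ l := by
            by_contra! hlt
            exact h ⟨hk, hlt⟩
          nlinarith
      obtain ⟨ε, hε, h₁, h₂⟩ := ih k l t (by omega) ht'
      obtain ⟨δ, hδ, e₁, e₂⟩ := extend ε (-1) hε (Or.inr rfl)
      obtain rfl : n = k + l := by omega
      refine ⟨δ, hδ, ?_, ?_⟩
      · rw [e₁, h₁]; push_cast; ring
      · rw [e₂, mul_add, h₂]; push_cast; ring

/-- Integer sign patterns produce points of `Λ_n`. -/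
lemma mem_Lam_of_signs {n : ℕ} {a b : ℤ} (ε : ℕ → ℤ) (hε : ∀ j, ε j = 1 ∨ ε j = -1)
    (ha : ∑ j ∈ Finset.range n, ε j = a)
    (hb : 3 * ∑ j ∈ Finset.range n, ε j * ((j : ℤ) + 1) = b) :
    ((a : ℝ), (b : ℝ)) ∈ Lam n := by
  refine ⟨fun j => (ε j : ℝ), fun j => ?_, ?_⟩
  · rcases hε j with h | h <;> simp [h]
  · rw [Fin.sum_univ_eq_sum_range (fun j => (ε j : ℝ) • Vvec j) n]
    refine Prod.ext ?_ ?_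
    · simp [Vvec, Prod.fst_sum, ← ha]
    · rw [Prod.snd_sum, ← hb]
      push_cast
      rw [Finset.mul_sum]
      refine Finset.sum_congr rfl fun j _ => ?_
      simp only [Vvec, Prod.smul_mk, smul_eq_mul]
      ring

/-- Let `n ≥ 1`, `a ∈ ℤ` with `|a| ≤ n` and `a ≡ n (mod 2)`. With
`M_{a,n} = (6a(n+1) + 3(n² − a²))/4` and `m_{a,n} = (6a(n+1) − 3(n² − a²))/4`,
the set `Λ_n` contains every `(a, b) ∈ ℤ²` with `m_{a,n} ≤ b ≤ M_{a,n}` and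
`b ≡ M_{a,n} (mod 6)`. -/
theorem stmt_7 (n : ℕ) (hn : 1 ≤ n) (a : ℤ) (ha : |a| ≤ (n : ℤ))
    (hpar : a % 2 = (n : ℤ) % 2)
    (M m : ℤ)
    (hM : 4 * M = 6 * a * ((n : ℤ) + 1) + 3 * ((n : ℤ) ^ 2 - a ^ 2))
    (hm : 4 * m = 6 * a * ((n : ℤ) + 1) - 3 * ((n : ℤ) ^ 2 - a ^ 2))
    (b : ℤ) (hb1 : m ≤ b) (hb2 : b ≤ M) (hb6 : (b - M) % 6 = 0) :
    ((a : ℝ), (b : ℝ)) ∈ Lam n := by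
  obtain ⟨h₁, h₂⟩ := abs_le.mp ha
  obtain ⟨k, hk⟩ : ∃ k : ℕ, (n : ℤ) + a = 2 * k := ⟨(((n : ℤ) + a) / 2).toNat, by omega⟩
  obtain ⟨l, hl⟩ : ∃ l : ℕ, (n : ℤ) - a = 2 * l := ⟨(((n : ℤ) - a) / 2).toNat, by omega⟩
  have hnkl : (n : ℤ) = k + l := by omega
  obtain rfl : a = (k : ℤ) - l := by omega
  rw [hnkl] at hM hm
  have hMm : M - m = 6 * ((k * l : ℕ) : ℤ) := by push_cast; linarith
  obtain ⟨t, ht⟩ : ∃ t : ℕ, b - m = 6 * t := ⟨((b - m) / 6).toNat, by omega⟩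
  obtain ⟨ε, hε, e₁, e₂⟩ := exists_signs n k l t (by omega) (by omega)
  exact mem_Lam_of_signs ε hε e₁ (by linarith)
end

section
/- Fix an integer m ≥ 2 and define u_m(z) := (1 − Σ_{k=1}^{m−1} z^k)/z^m for z ∈ ℂ, z ≠ 0. Then: (i) there exists R₀ > 0 such that for every R > R₀ there is a neighbourhood U of 1 in ℂ with the property that for all nonzero z ∈ U the point u_m(z) lies in the convex hull of the four points {Rz, −Rz, R(2−z), −R(2−z)}; (ii) there exists R₀ > 0 such that for every R > R₀ there is a neighbourhood Ũ of −1 in ℂ with the property that for all nonzero z ∈ Ũ the point u_m(z) lies in the convex hull of the four points {Rz, −Rz, R(2+z), −R(2+z)}. -/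
/-- `u_m(z) := (1 − Σ_{k=1}^{m−1} z^k)/z^m`. -/
noncomputable def uFun (m : ℕ) (z : ℂ) : ℂ :=
  (1 - ∑ k ∈ Finset.Icc 1 (m - 1), z ^ k) / z ^ m

/-- A parallelogram with vertices `±R p`, `±R q` contains every point
`s (p + q) / 2 + d (p - q) / 2` with `|s|, |d| ≤ R`. -/
theorem mem_convexHull_parallelogram {R s d : ℝ} (hR : 0 < R) (hs : |s| ≤ R) (hd : |d| ≤ R)
    (p q : ℂ) :
    (s : ℂ) * ((p + q) / 2) + d * ((p - q) / 2) ∈ convexHull ℝ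
      ({(R : ℂ) * p, -((R : ℂ) * p), (R : ℂ) * q, -((R : ℂ) * q)} : Set ℂ) := by
  set S : Set ℂ := {(R : ℂ) * p, -((R : ℂ) * p), (R : ℂ) * q, -((R : ℂ) * q)} with hS
  have h1 : (R : ℂ) * p ∈ convexHull ℝ S := subset_convexHull ℝ S (by simp [hS])
  have h2 : -((R : ℂ) * p) ∈ convexHull ℝ S := subset_convexHull ℝ S (by simp [hS])
  have h3 : (R : ℂ) * q ∈ convexHull ℝ S := subset_convexHull ℝ S (by simp [hS])
  have h4 : -((R : ℂ) * q) ∈ convexHull ℝ S := subset_convexHull ℝ S (by simp [hS])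
  have hc : Convex ℝ (convexHull ℝ S) := convex_convexHull ℝ S
  have weight : ∀ t : ℝ, |t| ≤ R → 0 ≤ (R + t) / (2 * R) ∧ 0 ≤ (R - t) / (2 * R) ∧
      (R + t) / (2 * R) + (R - t) / (2 * R) = 1 := by
    intro t ht
    have := abs_le.mp ht
    refine ⟨div_nonneg (by linarith) (by linarith), div_nonneg (by linarith) (by linarith), ?_⟩
    field_simp
    ring
  obtain ⟨hd1, hd2, hd3⟩ := weight d hd
  obtain ⟨hs1, hs2, hs3⟩ := weight s hs
  have key := hc (hc h1 h3 hd1 hd2 hd3) (hc h4 h2 hd1 hd2 hd3) hs1 hs2 hs3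
  convert key using 1
  have hR' : (R : ℂ) ≠ 0 := by exact_mod_cast hR.ne'
  simp only [Complex.real_smul]
  push_cast
  field_simp
  ring

open ComplexConjugate in
/-- A function commuting with conjugation and continuously differentiable at `1` takes, near `1`,
values in the parallelogram with vertices `±R z`, `±R (2 - z)`, for all large `R`. -/
theorem exists_forall_mem_convexHull_of_contDiffAt {f : ℂ → ℂ} (hf : ContDiffAt ℂ 1 f 1)
    (hconj : ∀ z, f (conj z) = conj (f z)) :
    ∃ R₀ > (0 : ℝ), ∀ R > R₀, ∀ᶠ z in nhds (1 : ℂ), f z ∈ convexHull ℝ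
      ({(R : ℂ) * z, -((R : ℂ) * z), (R : ℂ) * (2 - z), -((R : ℂ) * (2 - z))} : Set ℂ) := by
  obtain ⟨K, t, ht, hL⟩ := hf.exists_lipschitzOnWith
  refine ⟨K + ‖f 1‖ + 1, by positivity, fun R hR => ?_⟩
  have hK : (0 : ℝ) ≤ K := K.2
  have hf1 := norm_nonneg (f 1)
  have hcont : ContinuousAt (fun z : ℂ => ‖f z‖ + K * ‖z - 1‖) 1 :=
    hf.continuousAt.norm.add (by fun_prop)
  have hev : ∀ᶠ z in nhds (1 : ℂ), ‖f z‖ + K * ‖z - 1‖ < ‖f 1‖ + 1 :=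
    hcont.eventually_lt continuousAt_const (by simp)
  have hct : ∀ᶠ z in nhds (1 : ℂ), conj z ∈ t := by
    have : ContinuousAt (fun z : ℂ => conj z) 1 := Complex.continuous_conj.continuousAt
    exact this.eventually_mem (by simpa using ht)
  filter_upwards [hev, hct, ht] with z hz hzc hzt
  have him : |(f z).im| ≤ K * |z.im| := by
    have h := hL.dist_le_mul z hzt (conj z) hzc
    rw [hconj, dist_eq_norm, dist_eq_norm, Complex.sub_conj, Complex.sub_conj] at h
    simp only [norm_mul, Complex.norm_I, Complex.norm_real, Real.norm_eq_abs] at h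
    norm_num at h
    linarith
  set d : ℝ := (f z).im / z.im with hd
  have hdK : |d| ≤ K := by
    rw [hd, abs_div]
    exact div_le_of_le_mul₀ (abs_nonneg _) hK him
  have hdim : d * z.im = (f z).im := by
    by_cases h : z.im = 0
    · have : (f z).im = 0 := by simpa [h] using him
      simp [h, this]
    · exact div_mul_cancel₀ _ h
  have hs : |(f z).re - d * (z - 1).re| ≤ R := by
    have h1 := Complex.abs_re_le_norm (f z)
    have h2 : |d * (z - 1).re| ≤ K * ‖z - 1‖ := by
      rw [abs_mul]
      exact mul_le_mul hdK (Complex.abs_re_le_norm _) (abs_nonneg _) hK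
    have h3 := abs_sub (f z).re (d * (z - 1).re)
    linarith
  have key := mem_convexHull_parallelogram (by linarith) hs (by linarith : |d| ≤ R) z (2 - z)
  convert key using 1
  rw [show (z + (2 - z)) / 2 = 1 by ring, show (z - (2 - z)) / 2 = z - 1 by ring]
  apply Complex.ext <;> simp [hdim]

open ComplexConjugate in
theorem uFun_conj (m : ℕ) (z : ℂ) : uFun m (conj z) = conj (uFun m z) := by
  simp [uFun]

theorem contDiffAt_uFun (m : ℕ) {z : ℂ} (hz : z ≠ 0) : ContDiffAt ℂ 1 (uFun m) z := by
  unfold uFun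
  exact ContDiffAt.div (by fun_prop) (by fun_prop) (pow_ne_zero _ hz)

/-- Fix `m ≥ 2`. (i) There is `R₀ > 0` such that for every `R > R₀` there
is a neighbourhood `U` of `1` such that for all nonzero `z ∈ U`, `u_m(z)` lies in the
convex hull of `{Rz, −Rz, R(2−z), −R(2−z)}`. (ii) Similarly near `−1` with the
parallelogram `{±Rz, ±R(2+z)}`. -/
theorem stmt_8 (m : ℕ) (hm : 2 ≤ m) :
    (∃ R₀ > (0 : ℝ), ∀ R > R₀, ∃ U ∈ nhds (1 : ℂ), ∀ z ∈ U, z ≠ 0 →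
      uFun m z ∈ convexHull ℝ
        ({(R : ℂ) * z, -((R : ℂ) * z), (R : ℂ) * (2 - z), -((R : ℂ) * (2 - z))} : Set ℂ)) ∧
    (∃ R₀ > (0 : ℝ), ∀ R > R₀, ∃ U ∈ nhds (-1 : ℂ), ∀ z ∈ U, z ≠ 0 →
      uFun m z ∈ convexHull ℝ
        ({(R : ℂ) * z, -((R : ℂ) * z), (R : ℂ) * (2 + z), -((R : ℂ) * (2 + z))} : Set ℂ)) := by
  constructor
  · obtain ⟨R₀, h0, h⟩ :=
      exists_forall_mem_convexHull_of_contDiffAt (contDiffAt_uFun m one_ne_zero) (uFun_conj m)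
    exact ⟨R₀, h0, fun R hR => ⟨_, h R hR, fun z hz _ => hz⟩⟩
  · have hf : ContDiffAt ℂ 1 (fun z => uFun m (-z)) 1 :=
      (contDiffAt_uFun m (neg_ne_zero.mpr one_ne_zero)).comp (1 : ℂ) contDiff_neg.contDiffAt
    obtain ⟨R₀, h0, h⟩ := exists_forall_mem_convexHull_of_contDiffAt hf
      (fun z => by rw [← map_neg, uFun_conj])
    refine ⟨R₀, h0, fun R hR => ?_⟩
    have hneg : Filter.Tendsto (fun z : ℂ => -z) (nhds (-1)) (nhds 1) := by
      simpa using (continuous_neg (G := ℂ)).tendsto (-1)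
    refine ⟨_, hneg.eventually (h R hR), fun z hz _ => ?_⟩
    simp only [Set.mem_ofPred_eq, neg_neg, mul_neg, sub_neg_eq_add] at hz
    rwa [Set.insert_comm] at hz
end

section
/- Let Λ be a connected topological space, V a compact metric space, and t : Λ → Com V a continuous map, where Com V is the space of nonempty compact subsets of V with the Hausdorff metric. Suppose there exists λ₀ ∈ Λ such that t(λ₀) is a connected subset of V. Then the union t(Λ) := ⋃_{λ ∈ Λ} t(λ) is a connected subset of V. -/
/-- Let `Λ` be a connected topological space, `V` a compact metric space,
and `t : Λ → Com V` continuous, where `Com V` is the space of nonempty compact subsets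
of `V` with the Hausdorff metric. If `t(λ₀)` is connected for some `λ₀ ∈ Λ`, then the
union `t(Λ) = ⋃_{λ} t(λ)` is a connected subset of `V`. -/
theorem stmt_10 {Λ : Type*} [TopologicalSpace Λ] [ConnectedSpace Λ]
    {V : Type*} [MetricSpace V] [CompactSpace V]
    (t : Λ → TopologicalSpace.NonemptyCompacts V) (ht : Continuous t)
    (l₀ : Λ) (h0 : IsConnected (t l₀ : Set V)) :
    IsConnected (⋃ l : Λ, (t l : Set V)) := by
  let _ : TopologicalSpace (Set V) := TopologicalSpace.vietoris V
  refine ⟨h0.nonempty.mono (Set.subset_iUnion (fun l => (t l : Set V)) l₀), ?_⟩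
  have hcont : Continuous fun l => (t l : Set V) :=
    TopologicalSpace.NonemptyCompacts.continuous_coe.comp ht
  simpa using TopologicalSpace.vietoris.isPreconnected_biUnion isPreconnected_univ
    hcont.continuousOn ⟨l₀, Set.mem_univ l₀, h0.isPreconnected⟩
end

section
/- Let Λ be a compact and locally connected topological space, V a compact metric space, and t : Λ → Com V a continuous map, where Com V is the space of nonempty compact subsets of V with the Hausdorff metric. Let U ⊆ V be an open subset such that t(λ) ∩ U is discrete (in the subspace topology) for each λ ∈ Λ. Then the set t(Λ) ∩ U, where t(Λ) := ⋃_{λ ∈ Λ} t(λ), is locally connected in the subspace topology. -/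
open Set Filter Topology TopologicalSpace

section Vietoris

attribute [local instance] TopologicalSpace.vietoris

/-- Intersecting with an open set `B` is continuous for the Vietoris topology along a family of
sets that avoid the frontier of `B`. -/
theorem continuousOn_inter_of_disjoint_frontier {X Y : Type*} [TopologicalSpace X]
    [TopologicalSpace Y] {F : X → Set Y} {s : Set X} {B : Set Y} (hF : Continuous F)
    (hB : IsOpen B) (hs : ∀ x ∈ s, Disjoint (F x) (frontier B)) :
    ContinuousOn (fun x => F x ∩ B) s := by
  have hFs : Continuous (s.domRestrict F) := hF.comp continuous_subtype_val
  rw [continuousOn_iff_continuous_domRestrict, vietoris.continuous_iff]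
  refine ⟨fun O hO => ?_, fun C hC => ?_⟩
  · convert (hO.union (isClosed_closure (s := B)).isOpen_compl).powerset_vietoris.preimage hFs using 1
    ext ⟨x, hx⟩
    have h : ∀ y ∈ F x, y ∈ closure B → y ∈ B := fun y hy hyB => by
      by_contra hyn
      exact disjoint_left.1 (hs x hx) hy ⟨hyB, by rwa [hB.interior_eq]⟩
    have h' : ∀ y ∈ B, y ∈ closure B := fun y hy => subset_closure hy
    simp only [mem_preimage, domRestrict_apply, mem_powerset_iff, subset_def, mem_inter_iff,
      mem_union, mem_compl_iff]
    grind
  · convert (hC.union hB.isClosed_compl).powerset_vietoris.preimage hFs using 1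
    ext ⟨x, hx⟩
    simp only [mem_preimage, domRestrict_apply, mem_powerset_iff, subset_def, mem_inter_iff,
      mem_union, mem_compl_iff]
    grind

/-- If `x` is the only point of `t l` in the closure of an open set `B`, then for `m` close to `l`
the points of `t m` lying in `B` are joined to `x` by a connected set inside `B` swept out by
the sets `t m`. -/
theorem eventually_inter_subset_connectedComponentIn {X Y : Type*} [TopologicalSpace X]
    [LocallyConnectedSpace X] [TopologicalSpace Y] {t : X → NonemptyCompacts Y}
    (ht : Continuous t) {l : X} {x : Y} {B : Set Y} (hB : IsOpen B) (hxB : x ∈ B)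
    (hx : (t l : Set Y) ∩ closure B = {x}) :
    ∀ᶠ m in 𝓝 l, (t m : Set Y) ∩ B ⊆ connectedComponentIn ((⋃ m, (t m : Set Y)) ∩ B) x := by
  have hF : Continuous fun m => (t m : Set Y) := NonemptyCompacts.continuous_coe.comp ht
  have hxl : x ∈ (t l : Set Y) := (hx.symm.subset rfl).1
  have hN : {m | Disjoint (t m : Set Y) (frontier B)} ∈ 𝓝 l := by
    have ho := isClosed_frontier (s := B).isOpen_compl.powerset_vietoris.preimage hF
    have hl : (t l : Set Y) ⊆ (frontier B)ᶜ := fun y hy hyB => by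
      have hyx : y = x := hx.subset ⟨hy, hyB.1⟩
      rw [hB.frontier_eq, hyx] at hyB
      exact hyB.2 hxB
    filter_upwards [ho.mem_nhds hl] with m hm
    exact subset_compl_iff_disjoint_right.1 hm
  obtain ⟨N, hNl, hNc, hNs⟩ := locallyConnectedSpace_iff_connected_subsets.1 ‹_› l _ hN
  have hlB : (t l : Set Y) ∩ B = {x} :=
    ((inter_subset_inter_right _ subset_closure).trans hx.subset).antisymm
      (singleton_subset_iff.2 ⟨hxl, hxB⟩)
  have hl := mem_of_mem_nhds hNl
  have hc : IsPreconnected (⋃ m ∈ N, (t m : Set Y) ∩ B) :=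
    vietoris.isPreconnected_biUnion hNc
      (continuousOn_inter_of_disjoint_frontier hF hB hNs)
      ⟨l, hl, by rw [hlB]; exact isPreconnected_singleton⟩
  filter_upwards [hNl] with m hm
  refine (subset_biUnion_of_mem (u := fun m => (t m : Set Y) ∩ B) hm).trans
    (hc.subset_connectedComponentIn (mem_biUnion hl ⟨hxl, hxB⟩) ?_)
  exact iUnion₂_subset fun m _ => inter_subset_inter_left _ (subset_iUnion (fun m => (t m : Set Y)) m)

end Vietoris

/-- Let `Λ` be a compact, locally connected topological space, `V` a
compact metric space, and `t : Λ → Com V` continuous, where `Com V` is the space of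
nonempty compact subsets of `V` with the Hausdorff metric. If `U ⊆ V` is open and
`t(λ) ∩ U` is discrete for every `λ`, then `t(Λ) ∩ U` is locally connected in the
subspace topology. -/
theorem stmt_11 {Λ : Type*} [TopologicalSpace Λ] [CompactSpace Λ] [LocallyConnectedSpace Λ]
    {V : Type*} [MetricSpace V] [CompactSpace V]
    (t : Λ → TopologicalSpace.NonemptyCompacts V) (ht : Continuous t)
    (U : Set V) (hU : IsOpen U)
    (hdisc : ∀ l : Λ, DiscreteTopology (((t l : Set V) ∩ U : Set V))) :
    LocallyConnectedSpace (((⋃ l : Λ, (t l : Set V)) ∩ U : Set V)) := by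
  set T : Set V := ⋃ l, (t l : Set V)
  refine locallyConnectedSpace_iff_connected_subsets.2 fun x A hA => ?_
  obtain ⟨x, hxT, hxU⟩ := x
  obtain ⟨W, hW, hWA⟩ := mem_nhds_subtype _ _ _ |>.1 hA
  set C := connectedComponentIn (T ∩ (interior W ∩ U)) x
  have hWU : interior W ∩ U ∈ 𝓝 x := inter_mem (interior_mem_nhds.2 hW) (hU.mem_nhds hxU)
  have hCs : C ⊆ T ∩ (interior W ∩ U) := connectedComponentIn_subset _ _
  have hloc : ∀ l ∈ (univ : Set Λ), ∀ᶠ z : V × Λ in 𝓝 (x, l), z.1 ∈ (t z.2 : Set V) → z.1 ∈ C := by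
    intro l _
    by_cases hxl : x ∈ (t l : Set V)
    · obtain ⟨O, hO, hOx⟩ := discreteTopology_subtype_iff'.1 (hdisc l) x ⟨hxl, hxU⟩
      have hxO : x ∈ O := (hOx.symm.subset rfl).1
      obtain ⟨r, hr, hrs⟩ := Metric.nhds_basis_closedBall.mem_iff.1
        (inter_mem hWU (hO.mem_nhds hxO))
      have hcl : closure (Metric.ball x r) ⊆ (interior W ∩ U) ∩ O :=
        Metric.closure_ball_subset_closedBall.trans hrs
      have hxr := Metric.mem_ball_self (x := x) hr
      have key := eventually_inter_subset_connectedComponentIn ht Metric.isOpen_ball hxr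
        (l := l) (x := x) (Subset.antisymm
          (fun y hy => hOx.subset ⟨(hcl hy.2).2, hy.1, (hcl hy.2).1.2⟩)
          (singleton_subset_iff.2 ⟨hxl, subset_closure hxr⟩))
      rw [nhds_prod_eq]
      filter_upwards [prod_mem_prod (Metric.ball_mem_nhds x hr) key] with z hz hzt
      refine connectedComponentIn_mono x ?_ (hz.2 ⟨hzt, hz.1⟩)
      exact inter_subset_inter_right _ fun y hy => (hcl (subset_closure hy)).1
    · obtain ⟨P, Q, hP, hQ, hlP, hxQ, hPQ⟩ :=
        SeparatedNhds.of_isCompact_isClosed (t l).isCompact isClosed_singleton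
          (disjoint_singleton_right.2 hxl)
      have hlP' : ∀ᶠ m in 𝓝 l, (t m : Set V) ⊆ P :=
        ((NonemptyCompacts.isOpen_subsets_of_isOpen hP).preimage ht).mem_nhds hlP
      rw [nhds_prod_eq]
      filter_upwards [prod_mem_prod (hQ.mem_nhds (hxQ rfl)) hlP'] with z hz hzt
      exact (disjoint_left.1 hPQ (hz.2 hzt) hz.1).elim
  have hev := isCompact_univ.eventually_forall_of_forall_eventually
    (P := fun y l => y ∈ (t l : Set V) → y ∈ C) hloc
  refine ⟨Subtype.val ⁻¹' C, ?_, ?_, fun y hy => hWA (interior_subset (s := W) (hCs hy).2.1)⟩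
  · filter_upwards [continuous_subtype_val.continuousAt.eventually hev] with y hy
    obtain ⟨l, hl⟩ := mem_iUnion.1 y.2.1
    exact hy l (mem_univ l) hl
  · rw [← IsInducing.subtypeVal.isPreconnected_image, Subtype.image_preimage_coe,
      inter_eq_right.2 (hCs.trans (inter_subset_inter_right _ inter_subset_right))]
    exact isPreconnected_connectedComponentIn
end

section
/- Let M be a Hausdorff topological space, n ≥ 1 an integer, and let the symmetric group S_n act on the product M^n by permuting coordinates; let π : M^n → M^n/S_n be the quotient map onto the space of unordered n-tuples with the quotient topology. Then every continuous map f : [0,1] → M^n/S_n lifts to a continuous map g : [0,1] → M^n with f = π ∘ g. -/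
/-- The setoid on `M^n` identifying tuples up to a permutation of coordinates; its
quotient is the space of unordered `n`-tuples `M^n/S_n`. -/
def permSetoid (M : Type*) (n : ℕ) : Setoid (Fin n → M) where
  r f g := ∃ σ : Equiv.Perm (Fin n), f = g ∘ σ
  iseqv := by
    constructor
    · intro f; exact ⟨1, by ext x; simp⟩
    · rintro f g ⟨σ, rfl⟩; exact ⟨σ⁻¹, by ext x; simp⟩
    · rintro f g h ⟨σ, rfl⟩ ⟨τ, rfl⟩
      exact ⟨σ.trans τ, by ext x; simp⟩

open Set Filter Topology

section UnorderedTuples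

variable {ι M T : Type*}

/-- `U` is open and its trace on `K` is relatively clopen. -/
def IsSplitting [TopologicalSpace M] (K U : Set M) : Prop :=
  IsOpen U ∧ ∃ V, IsOpen V ∧ ∀ x ∈ K, x ∈ V ↔ x ∉ U

/-- No relatively clopen subset of `K` separates `x` from `y`. -/
def SameQuasicomponent [TopologicalSpace M] (K : Set M) (x y : M) : Prop :=
  ∀ U, IsSplitting K U → (x ∈ U ↔ y ∈ U)

/-- The union of the ranges of the tuples `r u`, for `u` between `s` and `t`. -/
def sweep [Lattice T] (r : T → ι → M) (s t : T) : Set M :=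
  ⋃ u ∈ uIcc s t, range (r u)

lemma range_subset_sweep [Lattice T] {r : T → ι → M} {s t u : T} (hu : u ∈ uIcc s t) :
    range (r u) ⊆ sweep r s t :=
  subset_biUnion_of_mem (u := fun u => range (r u)) hu

lemma sweep_mono [Lattice T] {r : T → ι → M} {s t s' t' : T} (h : uIcc s t ⊆ uIcc s' t') :
    sweep r s t ⊆ sweep r s' t' :=
  biUnion_subset_biUnion_left h

lemma sweep_comm [Lattice T] {r : T → ι → M} (s t : T) : sweep r s t = sweep r t s := by
  rw [sweep, uIcc_comm, sweep]

namespace IsSplitting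

variable [TopologicalSpace M] {K L U U' : Set M}

lemma anti (hKL : K ⊆ L) (hU : IsSplitting L U) : IsSplitting K U :=
  ⟨hU.1, hU.2.imp fun _ hV => ⟨hV.1, fun x hx => hV.2 x (hKL hx)⟩⟩

lemma univ : IsSplitting K univ :=
  ⟨isOpen_univ, ∅, isOpen_empty, by simp⟩

lemma inter (hU : IsSplitting K U) (hU' : IsSplitting K U') : IsSplitting K (U ∩ U') := by
  obtain ⟨hU, V, hV, h⟩ := hU
  obtain ⟨hU', V', hV', h'⟩ := hU'
  refine ⟨hU.inter hU', V ∪ V', hV.union hV', fun x hx => ?_⟩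
  simp only [mem_union, mem_inter_iff, h x hx, h' x hx]
  tauto

lemma biInter {α : Type*} (s : Finset α) {A : α → Set M} (hA : ∀ i ∈ s, IsSplitting K (A i)) :
    IsSplitting K (⋂ i ∈ s, A i) := by
  classical
  induction s using Finset.induction_on with
  | empty => simpa using univ
  | insert a s _ ih =>
    rw [Finset.set_biInter_insert]
    exact (hA a (by simp)).inter (ih fun i hi => hA i (by simp [hi]))

end IsSplitting

namespace SameQuasicomponent

variable [TopologicalSpace M] {K L : Set M} {x y z : M}

lemma mono (hKL : K ⊆ L) (h : SameQuasicomponent K x y) : SameQuasicomponent L x y :=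
  fun U hU => h U (hU.anti hKL)

lemma refl (K : Set M) (x : M) : SameQuasicomponent K x x := fun _ _ => Iff.rfl

lemma symm (h : SameQuasicomponent K x y) : SameQuasicomponent K y x :=
  fun U hU => (h U hU).symm

lemma trans (h : SameQuasicomponent K x y) (h' : SameQuasicomponent K y z) :
    SameQuasicomponent K x z :=
  fun U hU => (h U hU).trans (h' U hU)

lemma exists_isSplitting (hx : x ∈ K) (hy : y ∈ K) (h : ¬ SameQuasicomponent K x y) :
    ∃ U, IsSplitting K U ∧ x ∈ U ∧ y ∉ U := by
  simp only [SameQuasicomponent, not_forall] at h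
  obtain ⟨U, ⟨hU, V, hV, hUV⟩, h⟩ := h
  by_cases hxU : x ∈ U
  · exact ⟨U, ⟨hU, V, hV, hUV⟩, hxU, fun hyU => h (by simp [hxU, hyU])⟩
  · refine ⟨V, ⟨hV, U, hU, fun z hz => by simp [hUV z hz]⟩, (hUV x hx).2 hxU, ?_⟩
    rw [hUV y hy, not_not]
    by_contra hyU
    exact h (by simp [hxU, hyU])

/-- A quasicomponent of `K` can be cut out among finitely many points by one splitting set. -/
lemma exists_isSplitting_finset (s : Finset M) (hs : ↑s ⊆ K) (hx : x ∈ K) :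
    ∃ U, IsSplitting K U ∧ ∀ y ∈ s, y ∈ U ↔ SameQuasicomponent K x y := by
  classical
  have h (y : M) : ∃ U, IsSplitting K U ∧ x ∈ U ∧
      (y ∈ s → ¬ SameQuasicomponent K x y → y ∉ U) := by
    by_cases hy : y ∈ s ∧ ¬ SameQuasicomponent K x y
    · obtain ⟨U, hU, hxU, hyU⟩ := exists_isSplitting hx (hs hy.1) hy.2
      exact ⟨U, hU, hxU, fun _ _ => hyU⟩
    · exact ⟨Set.univ, .univ, trivial, fun h h' => (hy ⟨h, h'⟩).elim⟩
  choose A hA hxA hyA using h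
  have hsplit : IsSplitting K (⋂ y ∈ s, A y) := .biInter s fun y _ => hA y
  refine ⟨_, hsplit, fun y hy => ⟨fun hyU => ?_, fun hxy => ?_⟩⟩
  · by_contra hxy
    exact hyA y hy hxy (mem_iInter₂.1 hyU y hy)
  · exact (hxy _ hsplit).1 (mem_iInter₂.2 fun z _ => hxA z)

/-- Two tuples in `K` having equally many entries in each splitting set can be matched
within quasicomponents of `K`. -/
lemma exists_perm [Fintype ι] {a b : ι → M} (ha : range a ⊆ K) (hb : range b ⊆ K)
    (hcard : ∀ U, IsSplitting K U → Nat.card {i // a i ∈ U} = Nat.card {i // b i ∈ U}) :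
    ∃ σ : Equiv.Perm ι, ∀ i, SameQuasicomponent K (a i) (b (σ i)) := by
  classical
  let S : Setoid M := ⟨SameQuasicomponent K, refl K, symm, trans⟩
  have key (c : Quotient S) :
      Nonempty ({i // Quotient.mk S (a i) = c} ≃ {i // Quotient.mk S (b i) = c}) := by
    by_cases hc : ∃ p ∈ K, Quotient.mk S p = c
    · obtain ⟨p, hp, rfl⟩ := hc
      obtain ⟨U, hU, h⟩ := exists_isSplitting_finset
        (Finset.univ.image a ∪ Finset.univ.image b) (by simp [ha, hb]) hp
      have hq (x : M) : Quotient.mk S x = Quotient.mk S p ↔ SameQuasicomponent K p x :=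
        Quotient.eq.trans ⟨symm, symm⟩
      have ha' (i : ι) : Quotient.mk S (a i) = Quotient.mk S p ↔ a i ∈ U := by
        rw [hq, h _ (by simp)]
      have hb' (i : ι) : Quotient.mk S (b i) = Quotient.mk S p ↔ b i ∈ U := by
        rw [hq, h _ (by simp)]
      simp only [ha', hb']
      exact Finite.card_eq.1 (hcard U hU)
    · push Not at hc
      have : IsEmpty {i // Quotient.mk S (a i) = c} := ⟨fun i => hc _ (ha ⟨i, rfl⟩) i.2⟩
      have : IsEmpty {i // Quotient.mk S (b i) = c} := ⟨fun i => hc _ (hb ⟨i, rfl⟩) i.2⟩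
      exact ⟨Equiv.equivOfIsEmpty _ _⟩
  let e (c : Quotient S) := (key c).some
  exact ⟨Equiv.ofFiberEquiv e, fun i =>
    Quotient.exact (s := S) (Equiv.ofFiberEquiv_map e i).symm⟩

end SameQuasicomponent

lemma isOpen_setOf_le_card [TopologicalSpace M] [Fintype ι] {U : Set M} (hU : IsOpen U) (k : ℕ) :
    IsOpen {y : ι → M | k ≤ Nat.card {i // y i ∈ U}} := by
  rw [isOpen_iff_mem_nhds]
  intro y hy
  have hnear : ∀ᶠ z in 𝓝 y, ∀ i, y i ∈ U → z i ∈ U :=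
    eventually_all.2 fun i => by
      by_cases hi : y i ∈ U
      · filter_upwards [(continuous_apply i).continuousAt.eventually_mem (hU.mem_nhds hi)]
          with z hz _ using hz
      · simp [hi]
  filter_upwards [hnear] with z hz
  exact le_trans hy (Nat.card_le_card_of_injective
    (fun i : {i // y i ∈ U} => (⟨i.1, hz i.1 i.2⟩ : {i // z i ∈ U}))
    fun i j h => Subtype.ext (by simpa using h))

lemma isOpen_setOf_mem_of_invariant [TopologicalSpace M] [TopologicalSpace T] {n : ℕ}
    {r : T → Fin n → M} (hr : Continuous fun t => Quotient.mk (permSetoid M n) (r t))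
    {P : Set (Fin n → M)} (hP : IsOpen P)
    (hinv : ∀ (σ : Equiv.Perm (Fin n)) (y), y ∘ σ ∈ P ↔ y ∈ P) :
    IsOpen {t | r t ∈ P} := by
  let Q : Set (Quotient (permSetoid M n)) := {q | Quotient.liftOn q (· ∈ P) (by
    rintro _ b ⟨σ, rfl⟩
    exact propext (hinv σ b))}
  have hQ : IsOpen Q := isQuotientMap_quotient_mk'.isOpen_preimage.1 hP
  exact hQ.preimage hr

variable [TopologicalSpace M] [ConditionallyCompleteLinearOrder T] [TopologicalSpace T]
  [OrderTopology T] {n : ℕ} {r : T → Fin n → M}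

lemma card_mem_eq_of_isSplitting [DenselyOrdered T]
    (hr : Continuous fun t => Quotient.mk (permSetoid M n) (r t)) {s t : T}
    {U : Set M} (hU : IsSplitting (sweep r s t) U) :
    Nat.card {i // r s i ∈ U} = Nat.card {i // r t i ∈ U} := by
  classical
  obtain ⟨hU, V, hV, hUV⟩ := hU
  have hinv (W : Set M) (k : ℕ) (σ : Equiv.Perm (Fin n)) (y : Fin n → M) :
      y ∘ σ ∈ {y | k ≤ Nat.card {i // y i ∈ W}} ↔ y ∈ {y | k ≤ Nat.card {i // y i ∈ W}} := by
    have : Nat.card {i // (y ∘ σ) i ∈ W} = Nat.card {i // y i ∈ W} :=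
      Nat.card_congr (σ.subtypeEquiv fun _ => Iff.rfl)
    simp only [mem_ofPred_eq, this]
  have hopen {W : Set M} (hW : IsOpen W) (k : ℕ) :
      IsOpen {u | k ≤ Nat.card {i // r u i ∈ W}} :=
    isOpen_setOf_mem_of_invariant hr (isOpen_setOf_le_card hW k) (hinv W k)
  have hsum (u) (hu : u ∈ uIcc s t) :
      Nat.card {i // r u i ∈ U} + Nat.card {i // r u i ∈ V} = n := by
    simp only [hUV _ (range_subset_sweep hu ⟨_, rfl⟩)]
    rw [← Nat.card_sum, Nat.card_congr (Equiv.sumCompl _), Nat.card_fin]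
  have hnear {W : Set M} (hW : IsOpen W) (u : T) :
      ∀ᶠ v in 𝓝[uIcc s t] u, Nat.card {i // r u i ∈ W} ≤ Nat.card {i // r v i ∈ W} :=
    mem_nhdsWithin_of_mem_nhds ((hopen hW _).mem_nhds (le_refl (Nat.card {i // r u i ∈ W})))
  refine isPreconnected_uIcc.constant (f := fun u => Nat.card {i // r u i ∈ U})
    (fun u hu => ?_) left_mem_uIcc right_mem_uIcc
  refine tendsto_nhds_of_eventually_eq ?_
  filter_upwards [self_mem_nhdsWithin, hnear hU u, hnear hV u] with v hv hvU hvV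
  have := hsum u hu
  have := hsum v hv
  omega

/-- Reorderings of the tuples `r t` that are coherent along a finite set of parameters. -/
lemma exists_perm_coherent_finset [DenselyOrdered T]
    (hr : Continuous fun t => Quotient.mk (permSetoid M n) (r t)) (F : Finset T) :
    ∃ σ : T → Equiv.Perm (Fin n), ∀ s ∈ F, ∀ t ∈ F, ∀ i,
      SameQuasicomponent (sweep r s t) (r s (σ s i)) (r t (σ t i)) := by
  classical
  induction F using Finset.induction_on_max with
  | empty => exact ⟨1, by simp⟩
  | insert m F hm ih =>
    obtain ⟨σ, hσ⟩ := ih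
    obtain ⟨τ, hτ⟩ : ∃ τ : Equiv.Perm (Fin n), ∀ s ∈ F, ∀ i,
        SameQuasicomponent (sweep r s m) (r s (σ s i)) (r m (τ i)) := by
      rcases F.eq_empty_or_nonempty with rfl | hF
      · exact ⟨1, by simp⟩
      obtain ⟨ρ, hρ⟩ := SameQuasicomponent.exists_perm (K := sweep r (F.max' hF) m)
        (range_subset_sweep left_mem_uIcc) (range_subset_sweep right_mem_uIcc)
        fun U hU => card_mem_eq_of_isSplitting hr hU
      refine ⟨(σ (F.max' hF)).trans ρ, fun s hs i => ?_⟩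
      have h₁ : s ≤ F.max' hF := F.le_max' s hs
      have h₂ : F.max' hF ≤ m := (hm _ (F.max'_mem hF)).le
      have hmem : F.max' hF ∈ uIcc s m := by
        rw [uIcc_of_le (h₁.trans h₂)]
        exact ⟨h₁, h₂⟩
      exact ((hσ s hs _ (F.max'_mem hF) i).mono
        (sweep_mono (uIcc_subset_uIcc_left hmem))).trans
        ((hρ _).mono (sweep_mono (uIcc_subset_uIcc_right hmem)))
    have hne {s : T} (hs : s ∈ F) : s ≠ m := (hm s hs).ne
    refine ⟨Function.update σ m τ, fun s hs t ht i => ?_⟩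
    rcases Finset.mem_insert.1 hs with rfl | hs' <;>
      rcases Finset.mem_insert.1 ht with rfl | ht'
    · exact .refl _ _
    · simp only [Function.update_self, Function.update_of_ne (hne ht')]
      rw [sweep_comm]
      exact (hτ t ht' i).symm
    · simp only [Function.update_self, Function.update_of_ne (hne hs')]
      exact hτ s hs' i
    · simp only [Function.update_of_ne (hne hs'), Function.update_of_ne (hne ht')]
      exact hσ s hs' t ht' i

/-- Reorderings of the tuples `r t` that are coherent along all parameters, obtained from the
finite case by compactness of a product of finite discrete spaces. -/
lemma exists_perm_coherent [DenselyOrdered T]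
    (hr : Continuous fun t => Quotient.mk (permSetoid M n) (r t)) :
    ∃ σ : T → Equiv.Perm (Fin n), ∀ s t i,
      SameQuasicomponent (sweep r s t) (r s (σ s i)) (r t (σ t i)) := by
  classical
  let _ : TopologicalSpace (Equiv.Perm (Fin n)) := ⊥
  have : DiscreteTopology (Equiv.Perm (Fin n)) := ⟨rfl⟩
  let C (F : Finset T) : Set (T → Equiv.Perm (Fin n)) := {σ | ∀ s ∈ F, ∀ t ∈ F, ∀ i,
    SameQuasicomponent (sweep r s t) (r s (σ s i)) (r t (σ t i))}
  have hclosed (F : Finset T) : IsClosed (C F) := by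
    simp only [C, ofPred_forall]
    refine isClosed_iInter fun s => isClosed_iInter fun _ => isClosed_iInter fun t =>
      isClosed_iInter fun _ => isClosed_iInter fun i => ?_
    have hp : Continuous fun σ : T → Equiv.Perm (Fin n) => (σ s, σ t) := by fun_prop
    exact (isClosed_discrete {p : Equiv.Perm (Fin n) × Equiv.Perm (Fin n) |
      SameQuasicomponent (sweep r s t) (r s (p.1 i)) (r t (p.2 i))}).preimage hp
  have hanti : Antitone C := fun F G hFG σ hσ s hs t ht => hσ s (hFG hs) t (hFG ht)
  obtain ⟨σ, hσ⟩ := IsCompact.nonempty_iInter_of_directed_nonempty_isCompact_isClosed C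
    hanti.directed_ge (exists_perm_coherent_finset hr)
    (fun F => (hclosed F).isCompact) hclosed
  exact ⟨σ, fun s t => mem_iInter.1 hσ {s, t} s (by simp) t (by simp)⟩

lemma continuous_of_coherent [T2Space M]
    (hr : Continuous fun t => Quotient.mk (permSetoid M n) (r t)) {σ : T → Equiv.Perm (Fin n)}
    (hσ : ∀ s t i, SameQuasicomponent (sweep r s t) (r s (σ s i)) (r t (σ t i))) :
    Continuous fun t => r t ∘ σ t := by
  classical
  refine continuous_pi fun j => continuous_iff_continuousAt.2 fun t => ?_
  refine tendsto_nhds.2 fun W hW hj => ?_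
  change r t (σ t j) ∈ W at hj
  obtain ⟨U, V, hU, hV, hxU, hyV, hUV⟩ := SeparatedNhds.of_singleton_finset
    (x := r t (σ t j)) (s := (Finset.univ.image (r t)).erase (r t (σ t j))) (by simp)
  rw [singleton_subset_iff] at hxU
  let O : Set T := {s | r s ∈ {y | ∀ i, y i ∈ U ∩ W ∪ V}}
  have hO : IsOpen O := by
    refine isOpen_setOf_mem_of_invariant hr ?_ fun τ y => τ.forall_congr_left.trans (by simp)
    simp only [ofPred_forall]
    exact isOpen_iInter_of_finite fun i =>
      ((hU.inter hW).union hV).preimage (continuous_apply i)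
  have ht : t ∈ O := fun i => by
    by_cases hi : r t i = r t (σ t j)
    · exact .inl (hi ▸ ⟨hxU, hj⟩)
    · exact .inr (hyV (by simp [hi]))
  filter_upwards [ordConnectedComponent_mem_nhds.2 (hO.mem_nhds ht)] with s hs
  refine ((hσ t s j (U ∩ W) ⟨hU.inter hW, V, hV, fun x hx => ?_⟩).1 ⟨hxU, hj⟩).2
  obtain ⟨u, hu, i, rfl⟩ := mem_iUnion₂.1 hx
  exact ⟨fun hxV hxU => hUV.le_bot ⟨hxU.1, hxV⟩, fun hxU => (hs hu i).resolve_left hxU⟩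

end UnorderedTuples

/-- Let `M` be a Hausdorff space, `n ≥ 1`, and
`π : M^n → M^n/S_n` the quotient map onto the space of unordered `n`-tuples.
Every continuous `f : [0,1] → M^n/S_n` lifts to a continuous
`g : [0,1] → M^n` with `f = π ∘ g`. -/
theorem stmt_12 {M : Type*} [TopologicalSpace M] [T2Space M] (n : ℕ) (hn : 1 ≤ n)
    (f : unitInterval → Quotient (permSetoid M n)) (hf : Continuous f) :
    ∃ g : unitInterval → (Fin n → M), Continuous g ∧
      ∀ x, Quotient.mk (permSetoid M n) (g x) = f x := by
  obtain ⟨F, hF, hFf⟩ : ∃ F : ℝ → Quotient (permSetoid M n), Continuous F ∧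
      ∀ x : unitInterval, F x = f x :=
    ⟨IccExtend zero_le_one f, hf.Icc_extend', fun x => IccExtend_val _ f x⟩
  have hr : Continuous fun t => Quotient.mk (permSetoid M n) (F t).out := by
    simpa only [Quotient.out_eq] using hF
  obtain ⟨σ, hσ⟩ := exists_perm_coherent hr
  refine ⟨fun x => (F x).out ∘ σ x,
    (continuous_of_coherent hr hσ).comp continuous_subtype_val, fun x => ?_⟩
  rw [← hFf, ← Quotient.out_eq (F x)]
  exact Quotient.sound ⟨σ x, by simp only⟩
end

section
/- Let σ = (σ_1, …, σ_n) ∈ {−1,+1}^n be a finite sequence, and let M be its maximum number of consecutive equal symbols, i.e. M = max{ k ≥ 1 : σ_i = σ_{i+1} = ⋯ = σ_{i+k−1} for some 1 ≤ i ≤ n−k+1 }. Then there exists an index i₀ ∈ {1, …, n} such that the sequence σ′ obtained from σ by flipping the single digit at position i₀ (σ′_{i₀} = −σ_{i₀} and σ′_j = σ_j for j ≠ i₀) has maximum number of consecutive equal symbols at most max{3, M}. -/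
/-- A run avoiding the flipped position is a run of the original sequence. -/
theorem run_of_flip_of_avoids (σ : ℕ → ℤ) (i₀ i k : ℕ) (hi₀ : i₀ < i ∨ i + k ≤ i₀)
    (h : ∀ j < k, (fun l => if l = i₀ then -σ l else σ l) (i + j)
      = (fun l => if l = i₀ then -σ l else σ l) i) :
    ∀ j < k, σ (i + j) = σ i := by
  intro j hj
  have h1 := h j hj
  have h2 : i + j ≠ i₀ := by omega
  have h3 : i ≠ i₀ := by omega
  simpa [h2, h3] using h1

/-- Let `σ ∈ {−1,+1}^n` (entries `σ 0, …, σ (n−1)`), and let `M` be its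
maximum number of consecutive equal symbols. Then we can flip a single digit of `σ` so
that the resulting sequence has at most `max 3 M` consecutive equal symbols. -/
theorem stmt_13 (n : ℕ) (hn : 1 ≤ n) (σ : ℕ → ℤ)
    (hσ : ∀ i < n, σ i = 1 ∨ σ i = -1)
    (M : ℕ)
    (hMach : ∃ i, i + M ≤ n ∧ 1 ≤ M ∧ ∀ j < M, σ (i + j) = σ i)
    (hMmax : ∀ i k, i + k ≤ n → (∀ j < k, σ (i + j) = σ i) → k ≤ M) :
    ∃ i₀ < n, ∀ i k, i + k ≤ n →
      (∀ j < k, (fun l => if l = i₀ then -σ l else σ l) (i + j)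
        = (fun l => if l = i₀ then -σ l else σ l) i) →
      k ≤ max 3 M := by
  by_cases hmid : 4 ≤ n ∧ σ 1 = σ 2 ∧ σ 2 = σ 3
  · obtain ⟨hn4, h12, h23⟩ := hmid
    refine ⟨2, by omega, fun i k hik h => ?_⟩
    by_cases havoid : 2 < i ∨ i + k ≤ 2
    · exact le_max_of_le_right (hMmax i k hik (run_of_flip_of_avoids σ 2 i k havoid h))
    by_contra hk
    have h2 := hσ 2 (by omega)
    have hi : i = 0 ∨ i = 1 ∨ i = 2 := by omega
    rcases hi with rfl | rfl | rfl
    · have e1 := h 1 (by omega)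
      have e2 := h 2 (by omega)
      simp at e1 e2
      omega
    · have e1 := h 1 (by omega)
      simp at e1
      omega
    · have e1 := h 1 (by omega)
      simp at e1
      omega
  · refine ⟨0, by omega, fun i k hik h => ?_⟩
    by_cases havoid : 0 < i ∨ i + k ≤ 0
    · exact le_max_of_le_right (hMmax i k hik (run_of_flip_of_avoids σ 0 i k havoid h))
    by_contra hk
    obtain rfl : i = 0 := by omega
    have e1 := h 1 (by omega)
    have e2 := h 2 (by omega)
    have e3 := h 3 (by omega)
    simp at e1 e2 e3
    exact hmid ⟨by omega, by omega, by omega⟩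
end

section
/- For every integer N ≥ 1, the number of sign vectors (ε_0, ε_1, …, ε_{2^N − 1}) ∈ {−1,+1}^{2^N} for which the polynomial Σ_{k=0}^{2^N − 1} ε_k x^k is irreducible in ℤ[x] is at least 2^{2^N − 1}, i.e. at least half of all ±1-coefficient polynomials of degree 2^N − 1 are irreducible. -/
namespace Polynomial

theorem coeff_sum_fin_C_mul_X_pow {R : Type*} [Semiring R] {n : ℕ} (a : Fin n → R) (i : Fin n) :
    (∑ k, C (a k) * X ^ (k : ℕ)).coeff i = a i := by
  simp [finsetSum_coeff, coeff_C_mul, coeff_X_pow, Fin.val_inj]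

theorem natDegree_sum_fin_C_mul_X_pow {R : Type*} [Semiring R] {n : ℕ} (hn : 0 < n)
    (a : Fin n → R) (ha : a ⟨n - 1, by omega⟩ ≠ 0) :
    (∑ k, C (a k) * X ^ (k : ℕ)).natDegree = n - 1 := by
  refine natDegree_eq_of_le_of_coeff_ne_zero ?_ ?_
  · exact natDegree_sum_le_of_forall_le _ _ fun k _ =>
      (natDegree_C_mul_X_pow_le _ _).trans (by omega)
  · exact (coeff_sum_fin_C_mul_X_pow a ⟨n - 1, by omega⟩).symm ▸ ha

theorem sum_fin_X_pow_two_pow_eq (N : ℕ) :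
    (∑ k : Fin (2 ^ N), (X : (ZMod 2)[X]) ^ (k : ℕ)) = (X - C 1) ^ (2 ^ N - 1) := by
  have hX : (X - C 1 : (ZMod 2)[X]) ≠ 0 := X_sub_C_ne_zero 1
  refine mul_right_cancel₀ hX ?_
  rw [← pow_succ, Nat.sub_add_cancel Nat.one_le_two_pow, sub_pow_char_pow,
    Fin.sum_univ_eq_sum_range (fun k => (X : (ZMod 2)[X]) ^ k), C_1, geom_sum_mul, one_pow]

/-- A polynomial with coefficients `±1` of degree `2 ^ N - 1` whose value at `1` is not divisible
by `4` satisfies Eisenstein's criterion at `2` with respect to `X - 1`. -/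
theorem irreducible_sum_of_not_four_dvd {N : ℕ} (hN : 1 ≤ N) (a : Fin (2 ^ N) → ℤ)
    (ha : ∀ k, a k = -1 ∨ a k = 1) (h4 : ¬ (4 : ℤ) ∣ ∑ k, a k) :
    Irreducible (∑ k, C (a k) * X ^ (k : ℕ)) := by
  have hpos : 0 < 2 ^ N := by positivity
  have hunit (k) : IsUnit (a k) := Int.isUnit_iff.mpr (ha k).symm
  have hdeg := natDegree_sum_fin_C_mul_X_pow hpos a (hunit _).ne_zero
  have hcast (k) : ((a k : ℤ) : ZMod 2) = 1 := by
    rcases ha k with h | h <;> rw [h] <;> decide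
  have hlead : (∑ k, C (a k) * X ^ (k : ℕ)).leadingCoeff = a ⟨2 ^ N - 1, by omega⟩ := by
    rw [leadingCoeff, hdeg]
    exact coeff_sum_fin_C_mul_X_pow a ⟨2 ^ N - 1, by omega⟩
  refine generalizedEisenstein (K := ZMod 2) (q := X - C 1) (p := 2 ^ N - 1) ?_
    (monic_X_sub_C 1) ?_ ?_ ?_ ?_ ?_
  · simpa using irreducible_X_sub_C (1 : ZMod 2)
  · intro r hr
    rw [C_dvd_iff_dvd_coeff] at hr
    have := hr (⟨0, hpos⟩ : Fin (2 ^ N))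
    rw [coeff_sum_fin_C_mul_X_pow] at this
    exact isUnit_of_dvd_unit this (hunit _)
  · have := Nat.pow_le_pow_right two_pos hN
    omega
  · rw [hlead, algebraMap_int_eq, eq_intCast, hcast]
    exact one_ne_zero
  · rw [hlead, algebraMap_int_eq, eq_intCast, hcast, Polynomial.map_sub, map_X, map_C,
      map_one (Int.castRingHom _), ← sum_fin_X_pow_two_pow_eq, Polynomial.map_sum, C_1, one_mul]
    refine Finset.sum_congr rfl fun k _ => ?_
    rw [Polynomial.map_mul, map_C, Polynomial.map_pow, map_X, eq_intCast (Int.castRingHom _),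
      hcast, C_1, one_mul]
  · rw [modByMonic_X_sub_C_eq_C_eval, map_C, Ne, C_eq_zero, Ideal.Quotient.eq_zero_iff_mem,
      algebraMap_int_eq, ZMod.ker_intCastRingHom, Ideal.span_singleton_pow,
      Ideal.mem_span_singleton]
    simpa [eval_finsetSum] using h4

end Polynomial

theorem Fintype.card_le_two_mul_card_subtype_of_injective {α : Type*} [Fintype α] (p : α → Prop)
    [DecidablePred p] (f : α → α) (hf : Function.Injective f) (hp : ∀ x, ¬ p x → p (f x)) :
    Fintype.card α ≤ 2 * Fintype.card {x // p x} := by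
  have h := Fintype.card_le_of_injective
    (fun x : {x // ¬ p x} => (⟨f x, hp x x.2⟩ : {x // p x}))
    fun x y hxy => Subtype.ext (hf (congrArg Subtype.val hxy))
  rw [Fintype.card_subtype_compl] at h
  omega

/-- Change the sign of a single entry of a sign vector. -/
def flipSign {n : ℕ} (i : Fin n) (ε : Fin n → ({-1, 1} : Finset ℤ)) :
    Fin n → ({-1, 1} : Finset ℤ) :=
  Function.update ε i ⟨-(ε i : ℤ), by
    rcases Finset.mem_insert.mp (ε i).2 with h | h <;> simp_all⟩

theorem flipSign_injective {n : ℕ} (i : Fin n) : Function.Injective (flipSign i) := by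
  refine Function.Involutive.injective fun ε => ?_
  simp [flipSign]

theorem sum_flipSign {n : ℕ} (i : Fin n) (ε : Fin n → ({-1, 1} : Finset ℤ)) :
    ∑ k, (flipSign i ε k : ℤ) = ∑ k, (ε k : ℤ) - 2 * ε i := by
  rw [← Finset.add_sum_erase _ _ (Finset.mem_univ i),
    ← Finset.add_sum_erase _ (fun k => (ε k : ℤ)) (Finset.mem_univ i),
    Finset.sum_congr rfl fun k hk => by
      rw [flipSign, Function.update_of_ne (Finset.ne_of_mem_erase hk)]]
  simp only [flipSign, Function.update_self]
  ring

open Classical in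
/-- For every `N ≥ 1`, at least `2^(2^N − 1)` of the `2^(2^N)` sign
vectors `ε ∈ {−1,+1}^{2^N}` give an irreducible polynomial
`Σ_{k=0}^{2^N−1} ε_k x^k` in `ℤ[x]`; i.e. at least half of all `±1`-coefficient
polynomials of degree `2^N − 1` are irreducible. -/
theorem stmt_15 (N : ℕ) (hN : 1 ≤ N) :
    2 ^ (2 ^ N - 1) ≤ Fintype.card
      {ε : Fin (2 ^ N) → ({-1, 1} : Finset ℤ) //
        Irreducible (∑ k : Fin (2 ^ N),
          Polynomial.C ((ε k : ℤ)) * Polynomial.X ^ (k : ℕ))} := by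
  have hsign (ε : Fin (2 ^ N) → ({-1, 1} : Finset ℤ)) (k) : (ε k : ℤ) = -1 ∨ (ε k : ℤ) = 1 :=
    (Finset.mem_insert.mp (ε k).2).imp_right Finset.mem_singleton.mp
  have hpos : 0 < 2 ^ N := by positivity
  have h := Fintype.card_le_two_mul_card_subtype_of_injective
    (fun ε : Fin (2 ^ N) → ({-1, 1} : Finset ℤ) => Irreducible (∑ k : Fin (2 ^ N),
      Polynomial.C ((ε k : ℤ)) * Polynomial.X ^ (k : ℕ)))
    (flipSign ⟨0, hpos⟩) (flipSign_injective _) fun ε hε => by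
      refine Polynomial.irreducible_sum_of_not_four_dvd hN _ (hsign _) fun h4 => hε ?_
      refine Polynomial.irreducible_sum_of_not_four_dvd hN _ (hsign ε) fun h4' => ?_
      rw [sum_flipSign] at h4
      have := hsign ε ⟨0, hpos⟩
      omega
  have hcard : Fintype.card (Fin (2 ^ N) → ({-1, 1} : Finset ℤ)) = 2 * 2 ^ (2 ^ N - 1) := by
    rw [← pow_succ', Nat.sub_add_cancel hpos]
    simp
  rw [hcard] at h
  exact Nat.le_of_mul_le_mul_left h two_pos
end

section
/- Let S = (a_1, …, a_m) be a dominant string with a_1 > 1. Then for every integer n ≥ 1, the string S^n 1 1, obtained by concatenating n copies of S followed by the two digits 1, 1, is dominant. -/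
/-- The alternate lexicographic order `S << T` on strings (finite sequences of
positive integers, here 0-indexed lists): there is a first position where they differ,
and at that position (`k`-th entry, `k` 1-based) `S` is larger if `k` is odd and
smaller if `k` is even. -/
def StrLt (S T : List ℕ) : Prop :=
  ∃ j, j < S.length ∧ j < T.length ∧ (∀ i < j, S.getD i 0 = T.getD i 0) ∧
    (if j % 2 = 0 then T.getD j 0 < S.getD j 0 else S.getD j 0 < T.getD j 0)

/-- A string of even length is *dominant* if it is `<<`-smaller than each of its proper
suffixes. -/
def Dominant (S : List ℕ) : Prop :=
  S.length % 2 = 0 ∧ ∀ X Y : List ℕ, S = X ++ Y → X ≠ [] → Y ≠ [] → StrLt S Y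

theorem StrLt.append {S T : List ℕ} (h : StrLt S T) (A B : List ℕ) :
    StrLt (S ++ A) (T ++ B) := by
  obtain ⟨j, hS, hT, heq, hlt⟩ := h
  refine ⟨j, by simp; omega, by simp; omega, fun i hi => ?_, ?_⟩
  · rw [List.getD_append _ _ _ _ (by omega), List.getD_append _ _ _ _ (by omega)]
    exact heq i hi
  · rwa [List.getD_append _ _ _ _ hS, List.getD_append _ _ _ _ hT]

theorem StrLt.append_left {S T : List ℕ} (h : StrLt S T) {C : List ℕ}
    (hC : C.length % 2 = 0) : StrLt (C ++ S) (C ++ T) := by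
  obtain ⟨j, hS, hT, heq, hlt⟩ := h
  refine ⟨C.length + j, by simp; omega, by simp; omega, fun i hi => ?_, ?_⟩
  · by_cases hiC : i < C.length
    · rw [List.getD_append _ _ _ _ hiC, List.getD_append _ _ _ _ hiC]
    · rw [List.getD_append_right _ _ _ _ (by omega), List.getD_append_right _ _ _ _ (by omega)]
      exact heq _ (by omega)
  · rw [List.getD_append_right _ _ _ _ (by omega), List.getD_append_right _ _ _ _ (by omega)]
    simpa [Nat.add_mod, hC] using hlt

theorem strLt_of_head_lt {S T : List ℕ} (hS : S ≠ []) (hT : T ≠ [])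
    (h : T.getD 0 0 < S.getD 0 0) : StrLt S T :=
  ⟨0, List.length_pos_iff.2 hS, List.length_pos_iff.2 hT, by simp, by simpa using h⟩

theorem length_flatten_replicate_mod_two {S : List ℕ} (hS : S.length % 2 = 0) (n : ℕ) :
    (List.replicate n S).flatten.length % 2 = 0 := by
  simp [Nat.mul_mod, hS]

theorem flatten_replicate_append_getD_zero {S : List ℕ} (hS : S ≠ []) {n : ℕ} (hn : 1 ≤ n)
    (A : List ℕ) : ((List.replicate n S).flatten ++ A).getD 0 0 = S.getD 0 0 := by
  obtain ⟨k, rfl⟩ := Nat.exists_eq_add_of_le' hn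
  rw [List.replicate_succ, List.flatten_cons, List.append_assoc,
    List.getD_append _ _ _ _ (List.length_pos_iff.2 hS)]

/-- A power of a dominant string followed by `1 1` precedes every nonempty suffix of a lower
power followed by `1 1`, and every proper nonempty suffix of itself. -/
theorem Dominant.strLt_suffix {S : List ℕ} (hdom : Dominant S) (ha1 : 1 < S.getD 0 0)
    {n : ℕ} (hn : 1 ≤ n) (k : ℕ) (hk : k ≤ n) (X Z : List ℕ)
    (h : (List.replicate k S).flatten ++ [1, 1] = X ++ Z) (hZ : Z ≠ [])
    (hX : X ≠ [] ∨ k < n) : StrLt ((List.replicate n S).flatten ++ [1, 1]) Z := by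
  have hS : S ≠ [] := by rintro rfl; simp at ha1
  induction k generalizing X with
  | zero =>
    refine strLt_of_head_lt (by simp) hZ ?_
    rw [flatten_replicate_append_getD_zero hS hn]
    obtain ⟨z, Z, rfl⟩ := List.exists_cons_of_ne_nil hZ
    have hz : z ∈ [1, 1] := by
      have : z ∈ X ++ z :: Z := by simp
      simpa [← h] using this
    have : z = 1 := by simpa using hz
    simpa [this] using ha1
  | succ k ih =>
    have h' := h
    rw [List.replicate_succ, List.flatten_cons, List.append_assoc,
      List.append_eq_append_iff] at h'
    rcases h' with ⟨a, -, ha⟩ | ⟨c, hc, hcZ⟩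
    · exact ih (by omega) a ha (Or.inr hk)
    by_cases hc0 : c = []
    · subst hc0
      exact ih (by omega) [] (by simpa using hcZ.symm) (Or.inr hk)
    by_cases hX0 : X = []
    · subst hX0
      have hkn : k + 1 < n := by simpa using hX
      rw [List.nil_append] at h
      obtain ⟨d, rfl⟩ := Nat.exists_eq_add_of_lt hkn
      rw [← h, show k + 1 + d + 1 = (k + 1) + (d + 1) by ring, List.replicate_add,
        List.flatten_append, List.append_assoc]
      refine StrLt.append_left (strLt_of_head_lt (by simp) (by simp) ?_)
        (length_flatten_replicate_mod_two hdom.1 _)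
      rw [flatten_replicate_append_getD_zero hS (by omega)]
      simpa using ha1
    · obtain ⟨m, rfl⟩ := Nat.exists_eq_add_of_le' hn
      rw [hcZ, List.replicate_succ, List.flatten_cons, List.append_assoc]
      exact (hdom.2 X c hc hX0 hc0).append _ _

/-- If `S = (a_1, …, a_m)` is a dominant string with `a_1 > 1`, then for
every `n ≥ 1` the string `S^n 1 1` is dominant. -/
theorem stmt_16 (S : List ℕ) (hpos : ∀ x ∈ S, 0 < x) (hdom : Dominant S)
    (ha1 : 1 < S.getD 0 0) (n : ℕ) (hn : 1 ≤ n) :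
    Dominant ((List.replicate n S).flatten ++ [1, 1]) := by
  refine ⟨?_, fun X Y h hX hY => hdom.strLt_suffix ha1 hn n le_rfl X Y h hY (Or.inl hX)⟩
  rw [List.length_append, Nat.add_mod, length_flatten_replicate_mod_two hdom.1]
  rfl
end

section
/- Let a and b be odd positive integers with a < b, and let Z_{a,b} be the string (2, 1, 1, …, 1, 2, 1, 1, …, 1) consisting of a 2 followed by a ones, then a 2 followed by b ones. Then Z_{a,b} is dominant. -/
theorem getD_two_ones_two_ones (a b i : ℕ) :
    ([2] ++ List.replicate a 1 ++ [2] ++ List.replicate b 1).getD i 0 =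
      if i = 0 ∨ i = a + 1 then 2 else if i < a + b + 2 then 1 else 0 := by
  simp only [List.getD_eq_getElem?_getD, List.getElem?_append, List.length_append,
    List.length_replicate, List.length_singleton, List.getElem?_replicate,
    List.getElem?_singleton]
  grind

/-- Let `a < b` be odd positive integers, and let
`Z_{a,b} = (2, 1, …, 1, 2, 1, …, 1)` (a `2` followed by `a` ones, then a `2` followed
by `b` ones). Then `Z_{a,b}` is dominant. -/
theorem stmt_18 (a b : ℕ) (ha : Odd a) (hb : Odd b) (ha0 : 0 < a) (hb0 : 0 < b)
    (hab : a < b) :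
    Dominant ([2] ++ List.replicate a 1 ++ [2] ++ List.replicate b 1) := by
  set S := [2] ++ List.replicate a 1 ++ [2] ++ List.replicate b 1 with hS
  have hlen : S.length = a + b + 2 := by simp [hS]; omega
  have hget : ∀ i, S.getD i 0 =
      if i = 0 ∨ i = a + 1 then 2 else if i < a + b + 2 then 1 else 0 :=
    getD_two_ones_two_ones a b
  clear_value S
  rw [Nat.odd_iff] at ha hb
  refine ⟨by omega, fun X Y hXY hX hY => ?_⟩
  have hX' := List.length_pos_iff.mpr hX
  have hY' := List.length_pos_iff.mpr hY
  have hsum : X.length + Y.length = a + b + 2 := by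
    rw [← hlen, hXY, List.length_append]
  have hYget : ∀ i, Y.getD i 0 = S.getD (X.length + i) 0 := by
    intro i
    rw [hXY, List.getD_append_right _ _ _ _ (by omega), Nat.add_sub_cancel_left]
  by_cases hn : X.length = a + 1
  · refine ⟨a + 1, by omega, by omega, fun i hi => ?_, ?_⟩
    · rw [hYget, hget, hget]
      grind
    · rw [if_pos (by omega), hYget, hget, hget]
      grind
  · refine ⟨0, by omega, hY', fun i hi => absurd hi (by omega), ?_⟩
    rw [if_pos rfl, hYget, hget, hget]
    grind
end

section
/- Let S = (a_1, …, a_n) be a finite sequence of positive integers with n even, and set s_0 := 0, s_k := a_1 + ⋯ + a_k, and p := s_n. Suppose that p = 2^N for some integer N ≥ 1 and that the index ⟦S⟧ := Σ_{k=1}^{n} (−1)^k a_k satisfies ⟦S⟧ ≡ 2 (mod 4). Then the polynomial P(t) := 1 + Σ_{k=1}^{n} (−1)^k ( t^{s_{k−1}+1} + t^{s_{k−1}+2} + ⋯ + t^{s_k} ) − t^{p} has degree p − 1, all its coefficients in degrees 0 through p − 1 belong to {−1, +1}, and P is irreducible in ℤ[x]. -/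
open Polynomial in
/-- Eisenstein's criterion at `2` after the substitution `X ↦ X + 1`, for polynomials of degree
`2 ^ N - 1` with odd coefficients. -/
theorem irreducible_of_odd_coeff_of_eval_one {P : ℤ[X]} {N : ℕ} (hN : 1 ≤ N)
    (hdeg : P.natDegree = 2 ^ N - 1) (hcoeff : ∀ j < 2 ^ N, Odd (P.coeff j))
    (hprim : IsUnit P.leadingCoeff) (heval : P.eval 1 % 4 = 2) : Irreducible P := by
  have hpow : 2 ≤ 2 ^ N := by
    simpa using Nat.pow_le_pow_right (n := 2) (by norm_num) hN
  have hmap : P.map (Int.castRingHom (ZMod 2)) = ∑ i ∈ Finset.range (2 ^ N), X ^ i := by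
    ext j
    simp only [coeff_map, finsetSum_coeff, coeff_X_pow, Finset.sum_ite_eq, Finset.mem_range,
      eq_intCast]
    split_ifs with hj
    · exact (ZMod.intCast_eq_one_iff_odd).2 (hcoeff j hj)
    · rw [coeff_eq_zero_of_natDegree_lt (by omega), Int.cast_zero]
  have htaylor : (taylor 1 P).map (Int.castRingHom (ZMod 2)) = X ^ (2 ^ N - 1) := by
    have hcomp : (taylor 1 P).map (Int.castRingHom (ZMod 2)) =
        (P.map (Int.castRingHom (ZMod 2))).comp (X + 1) := by
      simp [taylor_apply, Polynomial.map_comp]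
    have hgeom := congrArg (fun Q : (ZMod 2)[X] => Q.comp (X + 1))
      (mul_geom_sum (X : (ZMod 2)[X]) (2 ^ N))
    simp only [mul_comp, sub_comp, X_comp, one_comp, add_sub_cancel_right, pow_comp] at hgeom
    rw [add_pow_char_pow, one_pow, add_sub_cancel_right] at hgeom
    rw [hcomp, hmap]
    refine mul_left_cancel₀ (X_ne_zero : (X : (ZMod 2)[X]) ≠ 0) ?_
    rw [hgeom, ← pow_succ', Nat.sub_add_cancel (by omega)]
  have hdeg' : (taylor 1 P).natDegree = 2 ^ N - 1 := by rw [natDegree_taylor, hdeg]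
  have hprime : (Ideal.span {(2 : ℤ)}).IsPrime :=
    (Ideal.span_singleton_prime (by norm_num)).2 Int.prime_two
  have hirr : Irreducible (taylor 1 P) := by
    refine irreducible_of_eisenstein_criterion hprime ?_ ?_ ?_ ?_ ?_
    · rw [leadingCoeff_taylor]
      exact fun h => hprime.ne_top (Ideal.eq_top_of_isUnit_mem _ h hprim)
    · intro j hj
      have hj' : j < 2 ^ N - 1 := hdeg' ▸ coe_lt_degree.1 hj
      have h := congrArg (fun Q => coeff Q j) htaylor
      rw [coeff_map, coeff_X_pow, if_neg hj'.ne, eq_intCast,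
        ZMod.intCast_zmod_eq_zero_iff_dvd] at h
      exact Ideal.mem_span_singleton.2 (by exact_mod_cast h)
    · rw [← natDegree_pos_iff_degree_pos, hdeg']
      omega
    · rw [taylor_coeff_zero, Ideal.span_singleton_pow, Ideal.mem_span_singleton]
      omega
    · intro r hr
      refine isUnit_of_dvd_unit ?_ hprim
      rw [← leadingCoeff_taylor (r := 1)]
      exact (C_dvd_iff_dvd_coeff r _).1 hr _
  exact (MulEquiv.irreducible_iff (taylorEquiv (1 : ℤ))).1 hirr

open Polynomial in
/-- The polynomial whose coefficients are `1` in degree `0` and `(-1) ^ k` in the degrees of the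
`k`-th block `(s (k - 1), s k]`, for `1 ≤ k ≤ m`. -/
noncomputable def blockPolynomial (s : ℕ → ℕ) (m : ℕ) : ℤ[X] :=
  1 + ∑ k ∈ Finset.Icc 1 m, C ((-1 : ℤ) ^ k) * ∑ j ∈ Finset.Icc (s (k - 1) + 1) (s k), X ^ j

open Polynomial in
theorem coeff_blockPolynomial_succ (s : ℕ → ℕ) (m j : ℕ) :
    (blockPolynomial s (m + 1)).coeff j = (blockPolynomial s m).coeff j +
      if s m < j ∧ j ≤ s (m + 1) then (-1) ^ (m + 1) else 0 := by
  rw [blockPolynomial, Finset.sum_Icc_succ_top (by omega), ← add_assoc, ← blockPolynomial,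
    coeff_add, coeff_C_mul, finsetSum_coeff]
  simp only [coeff_X_pow, Finset.sum_ite_eq, Finset.mem_Icc, Nat.add_sub_cancel,
    Nat.succ_le_iff, mul_ite, mul_one, mul_zero]

/-- A block polynomial has no terms beyond its last block. -/
theorem coeff_blockPolynomial_of_lt {s : ℕ → ℕ} (hs : Monotone s) {m j : ℕ} (hj : s m < j) :
    (blockPolynomial s m).coeff j = 0 := by
  induction m with
  | zero =>
    simp [blockPolynomial, Polynomial.coeff_one, (show j ≠ 0 by omega)]
  | succ m ih =>
    rw [coeff_blockPolynomial_succ, ih ((hs m.le_succ).trans_lt hj), if_neg (by omega), add_zero]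

theorem coeff_blockPolynomial_of_le {s : ℕ → ℕ} (hs : Monotone s) (hs0 : s 0 = 0) {m j : ℕ}
    (hj : j ≤ s m) :
    (blockPolynomial s m).coeff j = 1 ∨ (blockPolynomial s m).coeff j = -1 := by
  induction m with
  | zero =>
    obtain rfl : j = 0 := by omega
    simp [blockPolynomial]
  | succ m ih =>
    rw [coeff_blockPolynomial_succ]
    rcases le_or_gt j (s m) with h | h
    · simpa [h.not_gt] using ih h
    · rw [coeff_blockPolynomial_of_lt hs h, if_pos ⟨h, hj⟩, zero_add]
      exact neg_one_pow_eq_or ℤ _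

theorem coeff_blockPolynomial_last {s : ℕ → ℕ} (hs : Monotone s) {m : ℕ}
    (hm : s m < s (m + 1)) :
    (blockPolynomial s (m + 1)).coeff (s (m + 1)) = (-1) ^ (m + 1) := by
  rw [coeff_blockPolynomial_succ, coeff_blockPolynomial_of_lt hs hm, if_pos ⟨hm, le_rfl⟩, zero_add]

open Polynomial in
theorem eval_one_blockPolynomial (s : ℕ → ℕ) (m : ℕ) :
    (blockPolynomial s m).eval 1 =
      1 + ∑ k ∈ Finset.Icc 1 m, (-1 : ℤ) ^ k * ((s k - s (k - 1) : ℕ) : ℤ) := by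
  simp [blockPolynomial, eval_finsetSum]

/-- Let `S = (a_1, …, a_n)` be a finite sequence of positive integers
with `n` even, `s_k = a_1 + ⋯ + a_k`, `p = s_n`. If `p = 2^N` for some `N ≥ 1` and the
index `⟦S⟧ = Σ_{k=1}^n (−1)^k a_k` is `≡ 2 (mod 4)`, then the polynomial
`P(t) = 1 + Σ_{k=1}^n (−1)^k (t^{s_{k−1}+1} + ⋯ + t^{s_k}) − t^p` has degree `p − 1`,
all its coefficients in degrees `0, …, p − 1` lie in `{−1, +1}`, and `P` is irreducible
in `ℤ[x]`. -/
theorem stmt_19 (n : ℕ) (hn : 1 ≤ n) (hneven : n % 2 = 0) (a : ℕ → ℕ)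
    (hpos : ∀ k, 1 ≤ k → k ≤ n → 0 < a k)
    (N : ℕ) (hN : 1 ≤ N)
    (hp : (∑ i ∈ Finset.Icc 1 n, a i) = 2 ^ N)
    (hidx : (∑ k ∈ Finset.Icc 1 n, (-1 : ℤ) ^ k * (a k : ℤ)) % 4 = 2)
    (s : ℕ → ℕ) (hs : ∀ k, s k = ∑ i ∈ Finset.Icc 1 k, a i)
    (p : ℕ) (hpdef : p = s n)
    (P : Polynomial ℤ)
    (hP : P = 1 + ∑ k ∈ Finset.Icc 1 n, Polynomial.C ((-1 : ℤ) ^ k) *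
        (∑ j ∈ Finset.Icc (s (k - 1) + 1) (s k), Polynomial.X ^ j) -
        Polynomial.X ^ p) :
    P.natDegree = p - 1 ∧ (∀ k ≤ p - 1, P.coeff k = 1 ∨ P.coeff k = -1) ∧
      Irreducible P := by
  have hs_succ (k : ℕ) : s (k + 1) = s k + a (k + 1) := by
    rw [hs, hs, Finset.sum_Icc_succ_top (by omega)]
  have hs_mono : Monotone s := monotone_nat_of_le_succ fun k => by rw [hs_succ]; omega
  have hs_zero : s 0 = 0 := by simp [hs]
  have hp_pow : p = 2 ^ N := by rw [hpdef, hs, hp]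
  have hp_two : 2 ≤ p := by
    rw [hp_pow]
    simpa using Nat.pow_le_pow_right (n := 2) (by norm_num) hN
  replace hP : P = blockPolynomial s n - Polynomial.X ^ p := hP
  have hcoeff_lt (j : ℕ) (hj : j < p) : P.coeff j = 1 ∨ P.coeff j = -1 := by
    rw [hP, Polynomial.coeff_sub, Polynomial.coeff_X_pow, if_neg hj.ne, sub_zero]
    exact coeff_blockPolynomial_of_le hs_mono hs_zero (hpdef ▸ hj.le)
  have hcoeff_ge (j : ℕ) (hj : p ≤ j) : P.coeff j = 0 := by
    rw [hP, Polynomial.coeff_sub, Polynomial.coeff_X_pow]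
    rcases hj.eq_or_lt with rfl | hj
    · obtain ⟨m, rfl⟩ : ∃ m, n = m + 1 := ⟨n - 1, by omega⟩
      have hm : s m < s (m + 1) := by
        have := hpos (m + 1) (by omega) le_rfl
        rw [hs_succ]
        omega
      rw [hpdef, coeff_blockPolynomial_last hs_mono hm, if_pos rfl,
        (Nat.even_iff.2 hneven).neg_one_pow, sub_self]
    · rw [if_neg hj.ne', sub_zero, coeff_blockPolynomial_of_lt hs_mono (hpdef ▸ hj)]
  have hdeg : P.natDegree = p - 1 := by
    refine Polynomial.natDegree_eq_of_le_of_coeff_ne_zero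
      (Polynomial.natDegree_le_iff_coeff_eq_zero.2 fun j hj => hcoeff_ge j (by omega)) ?_
    rcases hcoeff_lt (p - 1) (by omega) with h | h <;> simp [h]
  have heval : P.eval 1 = ∑ k ∈ Finset.Icc 1 n, (-1 : ℤ) ^ k * (a k : ℤ) := by
    rw [hP, Polynomial.eval_sub, Polynomial.eval_pow, Polynomial.eval_X, one_pow,
      eval_one_blockPolynomial, add_sub_cancel_left]
    refine Finset.sum_congr rfl fun k hk => ?_
    obtain ⟨m, rfl⟩ : ∃ m, k = m + 1 := ⟨k - 1, by have := Finset.mem_Icc.1 hk; omega⟩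
    rw [Nat.add_sub_cancel, hs_succ, Nat.add_sub_cancel_left]
  refine ⟨hdeg, fun k hk => hcoeff_lt k (by omega),
    irreducible_of_odd_coeff_of_eval_one hN (hp_pow ▸ hdeg) (fun j hj => ?_) ?_
      (heval ▸ hidx)⟩
  · rcases hcoeff_lt j (hp_pow ▸ hj) with h | h <;> rw [h] <;> decide
  · rw [Polynomial.leadingCoeff, hdeg]
    exact Int.isUnit_iff.2 (hcoeff_lt (p - 1) (by omega))
end
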